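/- arXiv:2005.08723 — 4 statements merged into one kernel-verified Lean document; each statement's English description precedes it below -/
import Mathlib

section
/- (Generalized Morley theorem) Let A, B, C be an affinely independent triple of points in the Euclidean plane ℝ². Let X, Y, Z be points in the interior of the convex hull of {A, B, C}, and let D, E, F also be points in the interior of the convex hull of {A, B, C} such that D lies on both line BZ and line CY, E lies on both line CX and line AZ, and F lies on both line AY and line BX. Assume the angle conditions ∠BXC = 2π/3 + ∠YAZ, ∠CYA = 2π/3 + ∠ZBX, and ∠AZB = 2π/3 + ∠XCY. Assume moreover that X lies on the internal bisector of ∠BDC (i.e. ∠BDX = ∠XDC and X lies in the interior of the convex hull of {B, D, C}), that Y lies on the internal bisector of ∠CEA (i.e. ∠CEY = ∠YEA and Y lies in the interior of the convex hull of {C, E, A}), and that Z lies on the internal bisector of ∠AFB (i.e. ∠AFZ = ∠ZFB and Z lies in the interior of the convex hull of {A, F, B}). Then the triangle XYZ is equilateral, i.e. dist X Y = dist Y Z = dist Z X. -/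
open EuclideanGeometry Real

/-- The signed area form of the plane in coordinates. -/
def planeCross (v w : EuclideanSpace ℝ (Fin 2)) : ℝ := v 0 * w 1 - v 1 * w 0

/-- The complex number with the coordinates of a plane vector. -/
def planeToComplex (v : EuclideanSpace ℝ (Fin 2)) : ℂ := ⟨v 0, v 1⟩

lemma planeToComplex_sub (v w : EuclideanSpace ℝ (Fin 2)) :
    planeToComplex (v - w) = planeToComplex v - planeToComplex w := by
  apply Complex.ext <;> simp [planeToComplex]

lemma norm_sq_eq_coords (v : EuclideanSpace ℝ (Fin 2)) : ‖v‖ ^ 2 = v 0 ^ 2 + v 1 ^ 2 := by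
  simp [EuclideanSpace.norm_sq_eq]

lemma inner_eq_coords (v w : EuclideanSpace ℝ (Fin 2)) :
    inner ℝ v w = v 0 * w 0 + v 1 * w 1 := by
  simp [PiLp.inner_apply, mul_comm]

lemma sin_angle_mul_norms (v w : EuclideanSpace ℝ (Fin 2)) :
    sin (InnerProductGeometry.angle v w) * (‖v‖ * ‖w‖) = |planeCross v w| := by
  rw [InnerProductGeometry.sin_angle_mul_norm_mul_norm, ← Real.sqrt_sq_eq_abs]
  congr 1
  simp only [inner_eq_coords, planeCross]
  ring

lemma norm_pos_of_planeCross_ne_zero {v w : EuclideanSpace ℝ (Fin 2)}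
    (h : planeCross v w ≠ 0) : 0 < ‖v‖ ∧ 0 < ‖w‖ := by
  constructor <;> rw [norm_pos_iff] <;> rintro rfl <;> simp [planeCross] at h

lemma sin_angle_pos_of_planeCross_pos {v w : EuclideanSpace ℝ (Fin 2)}
    (h : 0 < planeCross v w) : 0 < sin (InnerProductGeometry.angle v w) := by
  obtain ⟨hv, hw⟩ := norm_pos_of_planeCross_ne_zero h.ne'
  have h1 := sin_angle_mul_norms v w
  rw [abs_of_pos h] at h1
  exact pos_of_mul_pos_left (h1 ▸ h) (by positivity)

/-- A positively oriented pair of vectors is related by the rotation through its angle. -/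
lemma norm_mul_planeToComplex {v w : EuclideanSpace ℝ (Fin 2)} (h : 0 < planeCross v w)
    {θ : ℝ} (hθ : InnerProductGeometry.angle v w = θ) :
    (‖v‖ : ℂ) * planeToComplex w = ‖w‖ * Complex.exp (θ * Complex.I) * planeToComplex v := by
  obtain ⟨hv, hw⟩ := norm_pos_of_planeCross_ne_zero h.ne'
  have h1 := sin_angle_mul_norms v w
  have h2 := InnerProductGeometry.cos_angle_mul_norm_mul_norm v w
  have h3 := norm_sq_eq_coords v
  rw [abs_of_pos h] at h1
  rw [hθ] at h1 h2
  rw [inner_eq_coords] at h2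
  unfold planeCross at h1
  rw [Complex.exp_mul_I, ← Complex.ofReal_cos, ← Complex.ofReal_sin]
  apply Complex.ext
  · simp [planeToComplex, -Complex.ofReal_cos, -Complex.ofReal_sin]
    refine mul_left_cancel₀ hv.ne' ?_
    linear_combination w 0 * h3 - v 0 * h2 + v 1 * h1
  · simp [planeToComplex, -Complex.ofReal_cos, -Complex.ofReal_sin]
    refine mul_left_cancel₀ hv.ne' ?_
    linear_combination w 1 * h3 - v 1 * h2 - v 0 * h1

lemma planeCross_pos_of_mem_interior {P Q R X : EuclideanSpace ℝ (Fin 2)}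
    (h : 0 < planeCross (Q - P) (R - P)) (hX : X ∈ interior (convexHull ℝ {P, Q, R})) :
    0 < planeCross (Q - P) (X - P) := by
  have hull : convexHull ℝ {P, Q, R} ⊆ {x | 0 ≤ planeCross (Q - P) (x - P)} := by
    apply convexHull_min
    · rintro x (rfl | rfl | rfl)
      · simp [planeCross]
      · simp [planeCross, mul_comm]
      · exact h.le
    · intro x hx y hy a b ha hb hab
      simp only [Set.mem_ofPred_eq] at hx hy ⊢
      have : planeCross (Q - P) (a • x + b • y - P)
          = a * planeCross (Q - P) (x - P) + b * planeCross (Q - P) (y - P) := by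
        obtain rfl : b = 1 - a := by linarith
        simp [planeCross]
        ring
      rw [this]
      positivity
  have hc : Filter.Tendsto (fun t : ℝ => X - t • (R - P)) (nhds 0) (nhds X) := by
    have : Continuous (fun t : ℝ => X - t • (R - P)) := by fun_prop
    simpa using this.tendsto 0
  have he := hc.eventually (mem_interior_iff_mem_nhds.1 hX)
  obtain ⟨t, ht, ht0⟩ :=
    ((he.filter_mono nhdsWithin_le_nhds).and (self_mem_nhdsWithin (s := Set.Ioi (0 : ℝ)))).exists
  have h1 := hull ht
  simp only [Set.mem_ofPred_eq] at h1
  have h2 : planeCross (Q - P) (X - t • (R - P) - P)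
      = planeCross (Q - P) (X - P) - t * planeCross (Q - P) (R - P) := by
    simp [planeCross]
    ring
  have h3 : 0 < t * planeCross (Q - P) (R - P) := mul_pos ht0 h
  linarith

lemma planeCross_rotate (P Q R : EuclideanSpace ℝ (Fin 2)) :
    planeCross (R - Q) (P - Q) = planeCross (Q - P) (R - P) := by
  simp [planeCross]
  ring

lemma insert_rotate {α : Type*} (a b c : α) : ({b, c, a} : Set α) = {a, b, c} := by
  ext x
  simp only [Set.mem_insert_iff, Set.mem_singleton_iff]
  tauto

lemma exists_eq_add_smul_of_mem_line {P Q D : EuclideanSpace ℝ (Fin 2)}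
    (h : D ∈ line[ℝ, P, Q]) : ∃ s : ℝ, D - P = s • (Q - P) := by
  obtain ⟨s, rfl⟩ := mem_affineSpan_pair_iff_exists_lineMap_eq.1 h
  exact ⟨s, by simp [AffineMap.lineMap_apply]⟩

/-- A point on the internal bisector is equidistant from the two sides of the angle, where the
sides are given as lines through `B`, `Z` and `C`, `Y`. -/
lemma equidistant_of_bisector {A B C X Y Z D : EuclideanSpace ℝ (Fin 2)}
    (h : 0 < planeCross (B - A) (C - A))
    (hY : Y ∈ interior (convexHull ℝ {A, B, C}))
    (hZ : Z ∈ interior (convexHull ℝ {A, B, C}))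
    (hD : D ∈ interior (convexHull ℝ {A, B, C}))
    (hDBZ : D ∈ line[ℝ, B, Z]) (hDCY : D ∈ line[ℝ, C, Y])
    (hXbis : ∠ B D X = ∠ X D C)
    (hXin : X ∈ interior (convexHull ℝ {B, D, C})) :
    0 < planeCross (X - B) (Z - B) ∧ 0 < planeCross (Y - C) (X - C) ∧
      planeCross (X - B) (Z - B) * ‖Y - C‖ = planeCross (Y - C) (X - C) * ‖Z - B‖ := by
  have hB : 0 < planeCross (C - B) (A - B) := by rwa [planeCross_rotate]
  rw [← insert_rotate] at hY hZ hD
  have hYB := planeCross_pos_of_mem_interior hB hY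
  have hZB := planeCross_pos_of_mem_interior hB hZ
  have hDB := planeCross_pos_of_mem_interior hB hD
  obtain ⟨s, hs⟩ := exists_eq_add_smul_of_mem_line hDBZ
  obtain ⟨r, hr⟩ := exists_eq_add_smul_of_mem_line hDCY
  have s0 : s * (Z 0 - B 0) = D 0 - B 0 := by simpa using congrArg (· 0) hs.symm
  have s1 : s * (Z 1 - B 1) = D 1 - B 1 := by simpa using congrArg (· 1) hs.symm
  have r0 : r * (Y 0 - C 0) = D 0 - C 0 := by simpa using congrArg (· 0) hr.symm
  have r1 : r * (Y 1 - C 1) = D 1 - C 1 := by simpa using congrArg (· 1) hr.symm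
  have hspos : 0 < s := by
    have : planeCross (C - B) (D - B) = s * planeCross (C - B) (Z - B) := by
      simp [planeCross]
      linear_combination (C 1 - B 1) * s0 - (C 0 - B 0) * s1
    exact pos_of_mul_pos_left (this ▸ hDB) hZB.le
  have hrpos : 0 < r := by
    have : planeCross (C - B) (D - B) = r * planeCross (C - B) (Y - B) := by
      simp [planeCross]
      linear_combination (C 1 - B 1) * r0 - (C 0 - B 0) * r1
    exact pos_of_mul_pos_left (this ▸ hDB) hYB.le
  have hX1 : s * planeCross (X - B) (Z - B) = planeCross (B - D) (X - D) := by
    simp [planeCross]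
    linear_combination (X 0 - B 0) * s1 - (X 1 - B 1) * s0
  have hX2 : r * planeCross (Y - C) (X - C) = planeCross (X - D) (C - D) := by
    simp [planeCross]
    linear_combination (X 1 - C 1) * r0 - (X 0 - C 0) * r1
  have hDpos : 0 < planeCross (B - D) (C - D) := by
    rwa [← planeCross_rotate]
  have hCpos : 0 < planeCross (D - C) (B - C) := by
    rwa [planeCross_rotate]
  have hX3 : 0 < planeCross (B - D) (X - D) :=
    planeCross_pos_of_mem_interior hDpos (by rwa [Set.insert_comm])
  have hX4 : 0 < planeCross (X - D) (C - D) := by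
    have := planeCross_pos_of_mem_interior hCpos (by rwa [← insert_rotate, Set.insert_comm])
    convert this using 1
    simp [planeCross]
    ring
  refine ⟨pos_of_mul_pos_right (hX1 ▸ hX3) hspos.le, pos_of_mul_pos_right (hX2 ▸ hX4) hrpos.le, ?_⟩
  have e1 := sin_angle_mul_norms (B - D) (X - D)
  have e2 := sin_angle_mul_norms (X - D) (C - D)
  have n1 : ‖B - D‖ = s * ‖Z - B‖ := by
    rw [norm_sub_rev, hs, norm_smul, Real.norm_of_nonneg hspos.le]
  have n2 : ‖C - D‖ = r * ‖Y - C‖ := by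
    rw [norm_sub_rev, hr, norm_smul, Real.norm_of_nonneg hrpos.le]
  have hang : InnerProductGeometry.angle (B - D) (X - D)
      = InnerProductGeometry.angle (X - D) (C - D) := hXbis
  rw [abs_of_pos hX3, ← hX1, hang, n1] at e1
  rw [abs_of_pos hX4, ← hX2, n2] at e2
  refine mul_left_cancel₀ (mul_pos hspos hrpos).ne' ?_
  linear_combination r * ‖Y - C‖ * (-e1) + s * ‖Z - B‖ * e2

/-- The hexagon with angles `α`, `2π/3 + γ`, ... closes up for the stated cosines. -/
lemma hexagon_closure (α β γ : ℝ) {w a b c : ℂ} (hw : w ^ 2 + w + 1 = 0)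
    (ha : a = Complex.exp (α * Complex.I)) (hb : b = Complex.exp (β * Complex.I))
    (hc : c = Complex.exp (γ * Complex.I)) :
    (cos ((α + β - γ) / 2) : ℂ) * (sin γ * b * (sin β - sin α * w * c))
      + cos ((β + γ - α) / 2) * (sin α * (w * c * sin γ - w ^ 2 * a * c * sin β))
      + cos ((γ + α - β) / 2) * (sin β * (w ^ 2 * a * sin α - a * b * sin γ)) = 0 := by
  have hexp (x y z : ℝ) : Complex.exp (((x + y - z) / 2 : ℝ) * Complex.I)
      = Complex.exp ((x / 2 : ℝ) * Complex.I) * Complex.exp ((y / 2 : ℝ) * Complex.I)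
        / Complex.exp ((z / 2 : ℝ) * Complex.I) := by
    rw [← Complex.exp_add, ← Complex.exp_sub]
    congr 1
    push_cast
    ring
  have hdouble (x : ℝ) : Complex.exp (x * Complex.I)
      = Complex.exp ((x / 2 : ℝ) * Complex.I) ^ 2 := by
    rw [← Complex.exp_nat_mul]
    congr 1
    push_cast
    ring
  have hcos (x : ℝ) : (cos x : ℂ)
      = (Complex.exp (x * Complex.I) + (Complex.exp (x * Complex.I))⁻¹) / 2 := by
    rw [Complex.ofReal_cos, Complex.cos, ← Complex.exp_neg, neg_mul]
  have hsin (x : ℝ) : (sin x : ℂ)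
      = ((Complex.exp (x * Complex.I))⁻¹ - Complex.exp (x * Complex.I)) * Complex.I / 2 := by
    rw [Complex.ofReal_sin, Complex.sin, ← Complex.exp_neg, neg_mul]
  rw [hcos, hcos, hcos, hexp, hexp, hexp, hsin, hsin, hsin, ha, hb, hc, hdouble α, hdouble β,
    hdouble γ]
  have hA := Complex.exp_ne_zero ((α / 2 : ℝ) * Complex.I)
  have hB := Complex.exp_ne_zero ((β / 2 : ℝ) * Complex.I)
  have hC := Complex.exp_ne_zero ((γ / 2 : ℝ) * Complex.I)
  generalize Complex.exp ((α / 2 : ℝ) * Complex.I) = A at *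
  generalize Complex.exp ((β / 2 : ℝ) * Complex.I) = B at *
  generalize Complex.exp ((γ / 2 : ℝ) * Complex.I) = C at *
  have hw2 : w ^ 2 = -1 - w := by linear_combination hw
  rw [hw2]
  field_simp
  ring

lemma norm_sub_sq_of_cos {v w : EuclideanSpace ℝ (Fin 2)} {l θ x y : ℝ}
    (hθ : InnerProductGeometry.angle v w = θ) (hs : 0 < sin θ)
    (hv : sin θ * ‖v‖ = l * cos x) (hw : sin θ * ‖w‖ = l * cos y) (hxy : θ = x + y) :
    ‖v - w‖ ^ 2 = l ^ 2 := by
  have h1 := norm_sub_sq_real v w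
  rw [← InnerProductGeometry.cos_angle_mul_norm_mul_norm, hθ] at h1
  have h2 : cos x ^ 2 + cos y ^ 2 - 2 * cos x * cos y * cos θ = sin θ ^ 2 := by
    rw [hxy, cos_add, sin_add]
    linear_combination (-cos y ^ 2) * sin_sq_add_cos_sq x - cos x ^ 2 * sin_sq_add_cos_sq y
  refine mul_left_cancel₀ (pow_pos hs 2).ne' ?_
  rw [h1]
  linear_combination (sin θ * ‖v‖ + l * cos x - 2 * cos θ * (sin θ * ‖w‖)) * hv
    + (sin θ * ‖w‖ + l * cos y - 2 * cos θ * (l * cos x)) * hw + l ^ 2 * h2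

lemma eq_zero_of_smul_add_smul_eq_zero {A B C : EuclideanSpace ℝ (Fin 2)}
    (h : 0 < planeCross (B - A) (C - A)) {m n : ℝ}
    (hmn : (m : ℂ) * (planeToComplex B - planeToComplex A)
      + n * (planeToComplex A - planeToComplex C) = 0) : m = 0 ∧ n = 0 := by
  have h0 : m * (B 0 - A 0) + n * (A 0 - C 0) = 0 := by
    simpa [planeToComplex] using congrArg Complex.re hmn
  have h1 : m * (B 1 - A 1) + n * (A 1 - C 1) = 0 := by
    simpa [planeToComplex] using congrArg Complex.im hmn
  constructor
  · refine (mul_eq_zero.1 (?_ : m * planeCross (B - A) (C - A) = 0)).resolve_right h.ne'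
    simp only [planeCross, PiLp.sub_apply]
    linear_combination (C 1 - A 1) * h0 - (C 0 - A 0) * h1
  · refine (mul_eq_zero.1 (?_ : n * planeCross (B - A) (C - A) = 0)).resolve_right h.ne'
    simp only [planeCross, PiLp.sub_apply]
    linear_combination (B 1 - A 1) * h0 - (B 0 - A 0) * h1

lemma exp_two_pi_div_three_sq :
    Complex.exp ((2 * π / 3 : ℝ) * Complex.I) ^ 2 + Complex.exp ((2 * π / 3 : ℝ) * Complex.I) + 1
      = 0 := by
  have h := Complex.isPrimitiveRoot_exp 3 (by norm_num)
  have h1 : Complex.exp (2 * π * Complex.I / (3 : ℕ))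
      = Complex.exp ((2 * π / 3 : ℝ) * Complex.I) := by
    congr 1
    push_cast
    ring
  rw [h1] at h
  have h2 := h.geom_sum_eq_zero (by norm_num)
  simp only [Finset.sum_range_succ, Finset.sum_range_zero] at h2
  linear_combination h2

/-- A hexagon `AZBXCY` with angles `α, β, γ` at `A, B, C` and exterior angles `2π/3 + γ`,
`2π/3 + α`, `2π/3 + β` at `Z, X, Y`, in which each of `X, Y, Z` is equidistant from the pair of
opposite sides given by `eX, eY, eZ`, has an equilateral inner triangle. -/
lemma equilateral_of_hexagon {A B C X Y Z : EuclideanSpace ℝ (Fin 2)} {α β γ : ℝ}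
    (hABC : 0 < planeCross (B - A) (C - A))
    (sX : 0 < planeCross (B - X) (C - X)) (sY : 0 < planeCross (C - Y) (A - Y))
    (sZ : 0 < planeCross (A - Z) (B - Z)) (sA : 0 < planeCross (Z - A) (Y - A))
    (sB : 0 < planeCross (X - B) (Z - B)) (sC : 0 < planeCross (Y - C) (X - C))
    (eX : planeCross (X - B) (Z - B) * ‖Y - C‖ = planeCross (Y - C) (X - C) * ‖Z - B‖)
    (eY : planeCross (Y - C) (X - C) * ‖Z - A‖ = planeCross (Z - A) (Y - A) * ‖X - C‖)
    (eZ : planeCross (Z - A) (Y - A) * ‖X - B‖ = planeCross (X - B) (Z - B) * ‖Y - A‖)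
    (hA : InnerProductGeometry.angle (Z - A) (Y - A) = α)
    (hB : InnerProductGeometry.angle (X - B) (Z - B) = β)
    (hC : InnerProductGeometry.angle (Y - C) (X - C) = γ)
    (hX : InnerProductGeometry.angle (B - X) (C - X) = 2 * π / 3 + α)
    (hY : InnerProductGeometry.angle (C - Y) (A - Y) = 2 * π / 3 + β)
    (hZ : InnerProductGeometry.angle (A - Z) (B - Z) = 2 * π / 3 + γ) :
    dist X Y = dist Y Z ∧ dist Y Z = dist Z X := by
  have hα0 : 0 ≤ α := hA ▸ InnerProductGeometry.angle_nonneg _ _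
  have hβ0 : 0 ≤ β := hB ▸ InnerProductGeometry.angle_nonneg _ _
  have hγ0 : 0 ≤ γ := hC ▸ InnerProductGeometry.angle_nonneg _ _
  have hα1 := hX ▸ InnerProductGeometry.angle_le_pi (B - X) (C - X)
  have hβ1 := hY ▸ InnerProductGeometry.angle_le_pi (C - Y) (A - Y)
  have hγ1 := hZ ▸ InnerProductGeometry.angle_le_pi (A - Z) (B - Z)
  have hsα : 0 < sin α := hA ▸ sin_angle_pos_of_planeCross_pos sA
  have hsβ : 0 < sin β := hB ▸ sin_angle_pos_of_planeCross_pos sB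
  have hsγ : 0 < sin γ := hC ▸ sin_angle_pos_of_planeCross_pos sC
  obtain ⟨hp, hq⟩ := norm_pos_of_planeCross_ne_zero sA.ne'
  obtain ⟨hr, ht⟩ := norm_pos_of_planeCross_ne_zero sB.ne'
  obtain ⟨hu, hv⟩ := norm_pos_of_planeCross_ne_zero sC.ne'
  have cA := sin_angle_mul_norms (Z - A) (Y - A)
  have cB := sin_angle_mul_norms (X - B) (Z - B)
  have cC := sin_angle_mul_norms (Y - C) (X - C)
  rw [abs_of_pos sA, hA] at cA
  rw [abs_of_pos sB, hB] at cB
  rw [abs_of_pos sC, hC] at cC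
  have R1 := norm_mul_planeToComplex sA hA
  have R2 := norm_mul_planeToComplex sZ hZ
  have R3 := norm_mul_planeToComplex sB hB
  have R4 := norm_mul_planeToComplex sX hX
  have R5 := norm_mul_planeToComplex sY hY
  rw [norm_sub_rev A Z, norm_sub_rev B Z] at R2
  rw [norm_sub_rev B X, norm_sub_rev C X] at R4
  rw [norm_sub_rev C Y, norm_sub_rev A Y] at R5
  have hadd (x : ℝ) : Complex.exp ((2 * π / 3 + x : ℝ) * Complex.I)
      = Complex.exp ((2 * π / 3 : ℝ) * Complex.I) * Complex.exp (x * Complex.I) := by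
    rw [← Complex.exp_add]
    congr 1
    push_cast
    ring
  rw [hadd] at R2 R4 R5
  simp only [planeToComplex_sub] at R1 R2 R3 R4 R5
  have hclosure := hexagon_closure α β γ exp_two_pi_div_three_sq rfl rfl rfl
  have hw := exp_two_pi_div_three_sq
  have hb0 := Complex.exp_ne_zero (β * Complex.I)
  have hw0 := Complex.exp_ne_zero ((2 * π / 3 : ℝ) * Complex.I)
  have YZ := fun l => norm_sub_sq_of_cos (l := l) (x := (α + β - γ) / 2) (y := (γ + α - β) / 2)
    hA hsα
  have ZX := fun l => norm_sub_sq_of_cos (l := l) (x := (β + γ - α) / 2) (y := (α + β - γ) / 2)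
    hB hsβ
  have XY := fun l => norm_sub_sq_of_cos (l := l) (x := (γ + α - β) / 2) (y := (β + γ - α) / 2)
    hC hsγ
  rw [sub_sub_sub_cancel_right] at YZ ZX XY
  have hhX : 0 < cos ((β + γ - α) / 2) :=
    cos_pos_of_mem_Ioo ⟨by linarith [pi_pos], by linarith [pi_pos]⟩
  generalize Complex.exp ((2 * π / 3 : ℝ) * Complex.I) = w at *
  generalize Complex.exp (α * Complex.I) = a at *
  generalize Complex.exp (β * Complex.I) = b at *
  generalize Complex.exp (γ * Complex.I) = c at *
  generalize cos ((α + β - γ) / 2) = kZ at *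
  generalize cos ((β + γ - α) / 2) = kX at *
  generalize cos ((γ + α - β) / 2) = kY at *
  rw [← cA, ← cB] at eZ
  rw [← cB, ← cC] at eX
  rw [← cC, ← cA] at eY
  clear cA cB cC sA sB sC sX sY sZ
  generalize ‖Z - A‖ = p at *
  generalize ‖Y - A‖ = q at *
  generalize ‖X - B‖ = r at *
  generalize ‖Z - B‖ = t at *
  generalize ‖Y - C‖ = u at *
  generalize ‖X - C‖ = v at *
  have fZ : sin α * p = sin β * t :=
    mul_right_cancel₀ (mul_pos hq hr).ne' (by linear_combination eZ)
  have fX : sin β * r = sin γ * v :=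
    mul_right_cancel₀ (mul_pos hu ht).ne' (by linear_combination eX)
  have fY : sin γ * u = sin α * q :=
    mul_right_cancel₀ (mul_pos hp hv).ne' (by linear_combination eY)
  obtain ⟨hm, hn⟩ : (kX * (sin α * p) - (sin β * r) * kZ) * (sin γ * u) = 0 ∧
      (kX * (sin γ * u) - (sin β * r) * kY) * (sin α * p) = 0 := by
    apply eq_zero_of_smul_add_smul_eq_zero hABC
    have gZ : (sin α * p : ℂ) = sin β * t := mod_cast fZ
    have gX : (sin β * r : ℂ) = sin γ * v := mod_cast fX
    have gY : (sin γ * u : ℂ) = sin α * q := mod_cast fY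
    have hp' : (p : ℂ) ≠ 0 := mod_cast hp.ne'
    have ht' : (t : ℂ) ≠ 0 := mod_cast ht.ne'
    have hr' : (r : ℂ) ≠ 0 := mod_cast hr.ne'
    have hq' : (q : ℂ) ≠ 0 := mod_cast hq.ne'
    have hα' : (sin α : ℂ) ≠ 0 := mod_cast hsα.ne'
    have hβ' : (sin β : ℂ) ≠ 0 := mod_cast hsβ.ne'
    have hγ' : (sin γ : ℂ) ≠ 0 := mod_cast hsγ.ne'
    simp only [Complex.ofReal_mul, Complex.ofReal_sub]
    generalize (sin α : ℂ) = sα at *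
    generalize (sin β : ℂ) = sβ at *
    generalize (sin γ : ℂ) = sγ at *
    generalize (p : ℂ) = p at *
    generalize (q : ℂ) = q at *
    generalize (r : ℂ) = r at *
    generalize (t : ℂ) = t at *
    generalize (u : ℂ) = u at *
    generalize (v : ℂ) = v at *
    generalize planeToComplex A = xA at *
    generalize planeToComplex B = xB at *
    generalize planeToComplex C = xC at *
    generalize planeToComplex X = xX at *
    generalize planeToComplex Y = xY at *
    generalize planeToComplex Z = xZ at *
    obtain ⟨U, hU⟩ : ∃ U, xZ - xA = p * U := ⟨(xZ - xA) / p, by field_simp⟩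
    have hw3 : w ^ 3 = 1 := by linear_combination (w - 1) * hw
    have d1 : xY - xA = q * a * U := mul_left_cancel₀ hp' (by linear_combination R1 + q * a * hU)
    have d2 : xB - xZ = -(t * w * c * U) :=
      mul_left_cancel₀ hp' (by linear_combination R2 - t * w * c * hU)
    have d3 : b * (xX - xB) = r * w * c * U :=
      mul_left_cancel₀ ht' (by linear_combination -R3 - r * d2)
    have d4 : b * (xC - xX) = -(v * w ^ 2 * a * c * U) :=
      mul_left_cancel₀ hr' (by linear_combination b * R4 - v * w * a * d3)
    have d6 : b * (xC - xY) = -(u * w ^ 2 * a * U) := by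
      refine mul_left_cancel₀ (mul_ne_zero hq' hw0) ?_
      linear_combination -R5 - u * d1 + q * u * a * U * hw3
    have vZ : sα * sβ * sγ * b * (xB - xA)
        = sα * p * (sγ * b * (sβ - sα * w * c)) * U := by
      linear_combination sα * sβ * sγ * b * (hU + d2) + sα * sγ * b * w * c * U * gZ
    have vX : sα * sβ * sγ * b * (xC - xB)
        = sβ * r * (sα * (w * c * sγ - w ^ 2 * a * c * sβ)) * U := by
      linear_combination sα * sβ * sγ * (d3 + d4) + sα * sβ * w ^ 2 * a * c * U * gX
    have vY : sα * sβ * sγ * b * (xA - xC)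
        = sγ * u * (sβ * (w ^ 2 * a * sα - a * b * sγ)) * U := by
      linear_combination -sα * sβ * sγ * (b * d1 + d6) + sβ * sγ * a * b * U * gY
    have hS : sα * sβ * sγ * b ≠ 0 :=
      mul_ne_zero (mul_ne_zero (mul_ne_zero hα' hβ') hγ') hb0
    refine mul_left_cancel₀ hS ?_
    linear_combination (kX * (sα * p) - (sβ * r) * kZ) * (sγ * u) * vZ
      + (kX * (sγ * u) - (sβ * r) * kY) * (sα * p) * vY
      - (sα * p) * (sγ * u) * (kX * (vZ + vX + vY) + (sβ * r) * U * hclosure)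
  have hm' := (mul_eq_zero.1 hm).resolve_right (mul_pos hsγ hu).ne'
  have hn' := (mul_eq_zero.1 hn).resolve_right (mul_pos hsα hp).ne'
  set l := sin β * r / kX with hl
  have lX : sin β * r = l * kX := by rw [hl]; field_simp
  have lZ : sin α * p = l * kZ := by rw [hl]; field_simp; linear_combination hm'
  have lY : sin γ * u = l * kY := by rw [hl]; field_simp; linear_combination hn'
  have YZ' := YZ l lZ (fY ▸ lY) (by ring)
  have ZX' := ZX l lX (fZ ▸ lZ) (by ring)
  have XY' := XY l lY (fX ▸ lX) (by ring)
  rw [dist_eq_norm, dist_eq_norm, dist_eq_norm, norm_sub_rev X Y, norm_sub_rev Y Z,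
    norm_sub_rev Z X]
  constructor
  · exact (sq_eq_sq₀ (norm_nonneg _) (norm_nonneg _)).1 (XY'.trans YZ'.symm)
  · exact (sq_eq_sq₀ (norm_nonneg _) (norm_nonneg _)).1 (YZ'.trans ZX'.symm)

lemma planeCross_ne_zero_of_affineIndependent {A B C : EuclideanSpace ℝ (Fin 2)}
    (h : AffineIndependent ℝ ![A, B, C]) : planeCross (B - A) (C - A) ≠ 0 := by
  intro h0
  rw [affineIndependent_iff_not_collinear_set] at h
  have hBA : B - A ≠ 0 := by
    rw [sub_ne_zero]
    rintro rfl
    exact h (by simpa using collinear_pair ℝ B C)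
  apply h
  rw [collinear_iff_of_mem (p₀ := A) (by simp)]
  refine ⟨B - A, ?_⟩
  have hn : (B - A) 0 ^ 2 + (B - A) 1 ^ 2 ≠ 0 := by
    rw [← norm_sq_eq_coords]
    positivity
  rintro p (rfl | rfl | rfl)
  · exact ⟨0, by simp⟩
  · exact ⟨1, by simp⟩
  · refine ⟨((p - A) 0 * (B - A) 0 + (p - A) 1 * (B - A) 1) / ((B - A) 0 ^ 2 + (B - A) 1 ^ 2), ?_⟩
    rw [vadd_eq_add, ← sub_eq_iff_eq_add]
    unfold planeCross at h0
    generalize p - A = x at *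
    generalize B - A = y at *
    ext i
    fin_cases i
    · simp
      field_simp
      linear_combination -y 1 * h0
    · simp
      field_simp
      linear_combination y 0 * h0

lemma generalized_morley_of_pos {A B C X Y Z D E F : EuclideanSpace ℝ (Fin 2)}
    (h : 0 < planeCross (B - A) (C - A))
    (hX : X ∈ interior (convexHull ℝ {A, B, C}))
    (hY : Y ∈ interior (convexHull ℝ {A, B, C}))
    (hZ : Z ∈ interior (convexHull ℝ {A, B, C}))
    (hD : D ∈ interior (convexHull ℝ {A, B, C}))
    (hE : E ∈ interior (convexHull ℝ {A, B, C}))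
    (hF : F ∈ interior (convexHull ℝ {A, B, C}))
    (hDBZ : D ∈ line[ℝ, B, Z]) (hDCY : D ∈ line[ℝ, C, Y])
    (hECX : E ∈ line[ℝ, C, X]) (hEAZ : E ∈ line[ℝ, A, Z])
    (hFAY : F ∈ line[ℝ, A, Y]) (hFBX : F ∈ line[ℝ, B, X])
    (hAngX : ∠ B X C = 2 * π / 3 + ∠ Y A Z)
    (hAngY : ∠ C Y A = 2 * π / 3 + ∠ Z B X)
    (hAngZ : ∠ A Z B = 2 * π / 3 + ∠ X C Y)
    (hXbis : ∠ B D X = ∠ X D C)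
    (hXin : X ∈ interior (convexHull ℝ {B, D, C}))
    (hYbis : ∠ C E Y = ∠ Y E A)
    (hYin : Y ∈ interior (convexHull ℝ {C, E, A}))
    (hZbis : ∠ A F Z = ∠ Z F B)
    (hZin : Z ∈ interior (convexHull ℝ {A, F, B})) :
    dist X Y = dist Y Z ∧ dist Y Z = dist Z X := by
  have hBC : 0 < planeCross (C - B) (A - B) := by rwa [planeCross_rotate]
  have hCA : 0 < planeCross (A - C) (B - C) := by rwa [planeCross_rotate]
  obtain ⟨sB, sC, eX⟩ := equidistant_of_bisector h hY hZ hD hDBZ hDCY hXbis hXin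
  have sZ : 0 < planeCross (A - Z) (B - Z) := by
    rw [← planeCross_rotate]
    exact planeCross_pos_of_mem_interior h hZ
  rw [← insert_rotate] at hX hY hZ hE hF
  obtain ⟨-, sA, eY⟩ := equidistant_of_bisector hBC hZ hX hE hECX hEAZ hYbis hYin
  have sX : 0 < planeCross (B - X) (C - X) := by
    rw [← planeCross_rotate]
    exact planeCross_pos_of_mem_interior hBC hX
  rw [← insert_rotate] at hX hY hZ hE hF
  obtain ⟨-, -, eZ⟩ := equidistant_of_bisector hCA hX hY hF hFAY hFBX hZbis hZin
  have sY : 0 < planeCross (C - Y) (A - Y) := by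
    rw [← planeCross_rotate]
    exact planeCross_pos_of_mem_interior hCA hY
  rw [EuclideanGeometry.angle_comm Y A Z] at hAngX
  rw [EuclideanGeometry.angle_comm Z B X] at hAngY
  rw [EuclideanGeometry.angle_comm X C Y] at hAngZ
  exact equilateral_of_hexagon h sX sY sZ sA sB sC eX eY eZ rfl rfl rfl hAngX hAngY hAngZ

theorem generalized_morley
    (A B C X Y Z D E F : EuclideanSpace ℝ (Fin 2))
    (hABC : AffineIndependent ℝ ![A, B, C])
    (hX : X ∈ interior (convexHull ℝ {A, B, C}))
    (hY : Y ∈ interior (convexHull ℝ {A, B, C}))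
    (hZ : Z ∈ interior (convexHull ℝ {A, B, C}))
    (hD : D ∈ interior (convexHull ℝ {A, B, C}))
    (hE : E ∈ interior (convexHull ℝ {A, B, C}))
    (hF : F ∈ interior (convexHull ℝ {A, B, C}))
    (hDBZ : D ∈ line[ℝ, B, Z]) (hDCY : D ∈ line[ℝ, C, Y])
    (hECX : E ∈ line[ℝ, C, X]) (hEAZ : E ∈ line[ℝ, A, Z])
    (hFAY : F ∈ line[ℝ, A, Y]) (hFBX : F ∈ line[ℝ, B, X])
    (hAngX : ∠ B X C = 2 * π / 3 + ∠ Y A Z)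
    (hAngY : ∠ C Y A = 2 * π / 3 + ∠ Z B X)
    (hAngZ : ∠ A Z B = 2 * π / 3 + ∠ X C Y)
    (hXbis : ∠ B D X = ∠ X D C)
    (hXin : X ∈ interior (convexHull ℝ {B, D, C}))
    (hYbis : ∠ C E Y = ∠ Y E A)
    (hYin : Y ∈ interior (convexHull ℝ {C, E, A}))
    (hZbis : ∠ A F Z = ∠ Z F B)
    (hZin : Z ∈ interior (convexHull ℝ {A, F, B})) :
    dist X Y = dist Y Z ∧ dist Y Z = dist Z X := by
  rcases (planeCross_ne_zero_of_affineIndependent hABC).lt_or_gt with h | h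
  · have h' : 0 < planeCross (C - A) (B - A) := by
      unfold planeCross at h ⊢
      linarith
    rw [Set.pair_comm] at hX hY hZ hD hE hF
    have swap (P Q R : EuclideanSpace ℝ (Fin 2)) : ({P, Q, R} : Set _) = {R, Q, P} := by
      rw [← insert_rotate, Set.insert_comm, Set.pair_comm, Set.insert_comm]
    rw [swap] at hXin hYin hZin
    rw [EuclideanGeometry.angle_comm B X C, EuclideanGeometry.angle_comm Y A Z] at hAngX
    rw [EuclideanGeometry.angle_comm C Y A, EuclideanGeometry.angle_comm Z B X] at hAngY
    rw [EuclideanGeometry.angle_comm A Z B, EuclideanGeometry.angle_comm X C Y] at hAngZ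
    rw [EuclideanGeometry.angle_comm, eq_comm, EuclideanGeometry.angle_comm] at hXbis hYbis hZbis
    obtain ⟨h1, h2⟩ := generalized_morley_of_pos h' hX hZ hY hD hF hE hDCY hDBZ hFBX hFAY hEAZ
      hECX hAngX hAngZ hAngY hXbis hXin hZbis hZin hYbis hYin
    rw [dist_comm X Y, dist_comm Y Z, dist_comm Z X]
    exact ⟨h2.symm, h1.symm⟩
  · exact generalized_morley_of_pos h hX hY hZ hD hE hF hDBZ hDCY hECX hEAZ hFAY hFBX hAngX hAngY
      hAngZ hXbis hXin hYbis hYin hZbis hZin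
end

section
/- (Perspectivity) Let A, B, C be an affinely independent triple of points in the Euclidean plane ℝ². Let X, Y, Z be points in the interior of the convex hull of {A, B, C}, and let D, E, F also be points in the interior of the convex hull of {A, B, C} such that D lies on both line BZ and line CY, E lies on both line CX and line AZ, and F lies on both line AY and line BX. Assume ∠BXC = 2π/3 + ∠YAZ, ∠CYA = 2π/3 + ∠ZBX, ∠AZB = 2π/3 + ∠XCY, and that X lies on the internal bisector of ∠BDC (∠BDX = ∠XDC and X lies in the interior of the convex hull of {B, D, C}), Y lies on the internal bisector of ∠CEA (∠CEY = ∠YEA and Y lies in the interior of the convex hull of {C, E, A}), and Z lies on the internal bisector of ∠AFB (∠AFZ = ∠ZFB and Z lies in the interior of the convex hull of {A, F, B}). Assume A ≠ X, B ≠ Y, and C ≠ Z. Then the triangles ABC and XYZ are perspective: there exists a point P lying on all three of the lines AX, BY, and CZ. -/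
open EuclideanGeometry Real

/-- Twice the signed area of the triangle `P Q R`. -/
def triDet (P Q R : EuclideanSpace ℝ (Fin 2)) : ℝ :=
  (Q 0 - P 0) * (R 1 - P 1) - (Q 1 - P 1) * (R 0 - P 0)

lemma abs_triDet (P Q R : EuclideanSpace ℝ (Fin 2)) :
    |triDet P Q R| = dist P Q * dist P R * sin (∠ Q P R) := by
  have h := InnerProductGeometry.sin_angle_mul_norm_mul_norm (Q -ᵥ P) (R -ᵥ P)
  rw [dist_comm P Q, dist_comm P R, dist_eq_norm_vsub (EuclideanSpace ℝ (Fin 2)),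
    dist_eq_norm_vsub (EuclideanSpace ℝ (Fin 2)) R, mul_comm, EuclideanGeometry.angle, h,
    ← Real.sqrt_sq_eq_abs]
  congr 1
  simp only [triDet, PiLp.inner_apply, Fin.sum_univ_two, vsub_eq_sub, PiLp.sub_apply,
    RCLike.inner_apply, conj_trivial]
  ring

lemma triDet_rotate (P Q R : EuclideanSpace ℝ (Fin 2)) : triDet Q R P = triDet P Q R := by
  simp only [triDet]; ring

lemma triDet_swap (P Q R : EuclideanSpace ℝ (Fin 2)) : triDet Q P R = -triDet P Q R := by
  simp only [triDet]; ring

lemma triDet_combination (A B C : EuclideanSpace ℝ (Fin 2)) {x y z : ℝ} (h : x + y + z = 1) :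
    triDet A B (x • A + y • B + z • C) = z * triDet A B C := by
  obtain rfl : x = 1 - y - z := by linarith
  simp [triDet]
  ring

lemma triDet_ne_zero_of_affineIndependent {A B C : EuclideanSpace ℝ (Fin 2)}
    (h : AffineIndependent ℝ ![A, B, C]) : triDet A B C ≠ 0 := by
  intro h0
  have hAB : A ≠ B := fun e => by simpa using h.injective.ne (show (0 : Fin 3) ≠ 1 by decide) e
  have hAC : A ≠ C := fun e => by simpa using h.injective.ne (show (0 : Fin 3) ≠ 2 by decide) e
  rw [affineIndependent_iff_not_collinear_set] at h
  apply h
  have h1 := abs_triDet A B C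
  rw [h0, abs_zero] at h1
  have h2 : sin (∠ B A C) = 0 := by
    have := dist_pos.2 hAB
    have := dist_pos.2 hAC
    simpa [hAB, hAC] using h1.symm
  have := collinear_iff_eq_or_eq_or_sin_eq_zero.2 (Or.inr (Or.inr h2))
  rwa [Set.insert_comm] at this

lemma affineIndependent_of_mem_interior {A B C T : EuclideanSpace ℝ (Fin 2)}
    (h : T ∈ interior (convexHull ℝ {A, B, C})) :
    AffineIndependent ℝ ![A, B, C] := by
  have h1 : affineSpan ℝ ({A, B, C} : Set (EuclideanSpace ℝ (Fin 2))) = ⊤ :=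
    interior_convexHull_nonempty_iff_affineSpan_eq_top.1 ⟨T, h⟩
  rw [affineIndependent_iff_finrank_vectorSpan_eq ℝ ![A, B, C] (n := 2) (by simp)]
  have h2 : Set.range ![A, B, C] = {A, B, C} := by
    rw [Matrix.range_cons, Matrix.range_cons_cons_empty, Set.singleton_union]
  rw [h2, AffineSubspace.vectorSpan_eq_top_of_affineSpan_eq_top ℝ _ _ h1]
  simp

lemma exists_pos_weights {A B C T : EuclideanSpace ℝ (Fin 2)}
    (h : T ∈ interior (convexHull ℝ {A, B, C})) :
    ∃ x y z : ℝ, 0 < x ∧ 0 < y ∧ 0 < z ∧ x + y + z = 1 ∧ T = x • A + y • B + z • C := by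
  have h1 : affineSpan ℝ ({A, B, C} : Set (EuclideanSpace ℝ (Fin 2))) = ⊤ :=
    interior_convexHull_nonempty_iff_affineSpan_eq_top.1 ⟨T, h⟩
  have h2 : Set.range ![A, B, C] = {A, B, C} := by
    rw [Matrix.range_cons, Matrix.range_cons_cons_empty, Set.singleton_union]
  let b : AffineBasis (Fin 3) ℝ (EuclideanSpace ℝ (Fin 2)) :=
    ⟨![A, B, C], affineIndependent_of_mem_interior h, by rw [h2, h1]⟩
  have hb : Set.range b = {A, B, C} := h2
  have hw : ∀ i, 0 < b.coord i T := by
    rw [← hb, b.interior_convexHull] at h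
    exact h
  refine ⟨b.coord 0 T, b.coord 1 T, b.coord 2 T, hw 0, hw 1, hw 2, ?_, ?_⟩
  · rw [← b.sum_coord_apply_eq_one T, Fin.sum_univ_three]
  · have := b.linear_combination_coord_eq_self T
    rw [Fin.sum_univ_three] at this
    exact this.symm

lemma triDet_ne_zero_of_mem_interior {A B C T : EuclideanSpace ℝ (Fin 2)}
    (h : T ∈ interior (convexHull ℝ {A, B, C})) : triDet A B T ≠ 0 := by
  have h0 := triDet_ne_zero_of_affineIndependent (affineIndependent_of_mem_interior h)
  obtain ⟨x, y, z, -, -, hz, hs, rfl⟩ := exists_pos_weights h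
  rw [triDet_combination A B C hs]
  exact mul_ne_zero hz.ne' h0

lemma angle_pos_lt_pi_of_triDet_ne_zero {P Q R : EuclideanSpace ℝ (Fin 2)}
    (h : triDet P Q R ≠ 0) : 0 < ∠ Q P R ∧ ∠ Q P R < π ∧ 0 < sin (∠ Q P R) := by
  have h1 := abs_pos.2 h
  rw [abs_triDet] at h1
  have h2 : sin (∠ Q P R) ≠ 0 := right_ne_zero_of_mul h1.ne'
  have h3 : 0 < ∠ Q P R := lt_of_le_of_ne (angle_nonneg _ _ _) fun e => h2 (by rw [← e, sin_zero])
  have h4 : ∠ Q P R < π := lt_of_le_of_ne (angle_le_pi _ _ _) fun e => h2 (by rw [e, sin_pi])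
  exact ⟨h3, h4, sin_pos_of_pos_of_lt_pi h3 h4⟩

lemma ne_of_triDet_ne_zero {P Q R : EuclideanSpace ℝ (Fin 2)} (h : triDet P Q R ≠ 0) :
    P ≠ Q ∧ P ≠ R ∧ Q ≠ R := by
  refine ⟨?_, ?_, ?_⟩ <;> rintro rfl <;> exact h (by simp only [triDet]; ring)

lemma angle_add_of_mem_interior {A B C T : EuclideanSpace ℝ (Fin 2)}
    (h : T ∈ interior (convexHull ℝ {A, B, C})) : ∠ A B C = ∠ A B T + ∠ T B C := by
  have hT := (ne_of_triDet_ne_zero (triDet_ne_zero_of_mem_interior h)).2.2.symm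
  obtain ⟨x, y, z, hx, -, hz, hs, e⟩ := exists_pos_weights h
  refine InnerProductGeometry.angle_eq_angle_add_add_angle_add_of_mem_span
    (vsub_ne_zero.2 hT) (Submodule.mem_span_pair.2 ⟨⟨x, hx.le⟩, ⟨z, hz.le⟩, ?_⟩)
  obtain rfl : y = 1 - x - z := by linarith
  rw [e]
  change x • (A - B) + z • (C - B) = x • A + (1 - x - z) • B + z • C - B
  module

/-- Two interior points of a triangle on a line through a vertex lie on the same ray. -/
lemma exists_pos_smul_of_mem_line {A B C Z D : EuclideanSpace ℝ (Fin 2)}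
    (hZ : Z ∈ interior (convexHull ℝ {A, B, C})) (hD : D ∈ interior (convexHull ℝ {A, B, C}))
    (h : D ∈ line[ℝ, B, Z]) : ∃ r : ℝ, 0 < r ∧ r • (Z -ᵥ B) = D -ᵥ B := by
  have h0 := triDet_ne_zero_of_affineIndependent (affineIndependent_of_mem_interior hZ)
  obtain ⟨r, rfl⟩ := (mem_affineSpan_pair_iff_exists_lineMap_eq).1 h
  refine ⟨r, ?_, by simp [AffineMap.lineMap_apply]⟩
  obtain ⟨x, y, z, -, -, hz, hs, hZe⟩ := exists_pos_weights hZ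
  obtain ⟨x', y', z', -, -, hz', hs', hDe⟩ := exists_pos_weights hD
  have e1 : triDet A B Z = z * triDet A B C := by rw [hZe, triDet_combination A B C hs]
  have e2 : triDet A B (AffineMap.lineMap B Z r) = z' * triDet A B C := by
    rw [hDe, triDet_combination A B C hs']
  have e3 : triDet A B (AffineMap.lineMap B Z r) = r * triDet A B Z := by
    simp [triDet, AffineMap.lineMap_apply]
    ring
  have e4 : r * z = z' := mul_right_cancel₀ h0 (by rw [← e2, e3, e1]; ring)
  exact pos_of_mul_pos_left (e4 ▸ hz') hz.le

lemma angle_eq_of_mem_line {A B C Z D : EuclideanSpace ℝ (Fin 2)} (Q : EuclideanSpace ℝ (Fin 2))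
    (hZ : Z ∈ interior (convexHull ℝ {A, B, C})) (hD : D ∈ interior (convexHull ℝ {A, B, C}))
    (h : D ∈ line[ℝ, B, Z]) : ∠ D B Q = ∠ Z B Q := by
  obtain ⟨r, hr, e⟩ := exists_pos_smul_of_mem_line hZ hD h
  exact angle_smul_left_of_pos Q hr e

lemma sin_add_mul_cos_eq {a b c u v : ℝ} (huv : u + v = π / 3 - a)
    (h0 : sin (u + v) ≠ 0) (h : sin u * sin c = sin b * sin v) :
    sin (v + c) * (sin b * cos ((π / 3 - (a + b + c)) / 2 + b)) =
      sin (u + b) * (sin c * cos ((π / 3 - (a + b + c)) / 2 + c)) := by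
  have key : ∀ p q s t : ℝ, sin p * sin t = sin s * sin q →
      sin (p + s) * sin (p + q) = sin p * (sin (p + q + s) + sin t) := by
    intro p q s t hst
    rw [mul_add, hst, sin_add, sin_add, sin_add (p + q) s, sin_add, cos_add]
    linear_combination (sin s * sin q) * sin_sq_add_cos_sq p
  have h1 := key u v b c h
  have h2 := key v u c b (by linarith)
  rw [sin_add_sin, huv] at h1
  rw [sin_add_sin, add_comm v u, huv] at h2
  rw [huv] at h0
  rw [show (π / 3 - a + b + c) / 2 = (π / 3 - a + c + b) / 2 by ring,
    show (π / 3 - a + b - c) / 2 = (π / 3 - (a + b + c)) / 2 + b by ring] at h1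
  rw [show (π / 3 - a + c - b) / 2 = (π / 3 - (a + b + c)) / 2 + c by ring] at h2
  apply mul_right_cancel₀ h0
  linear_combination
    (sin b * cos ((π / 3 - (a + b + c)) / 2 + b)) * h2 -
      (sin c * cos ((π / 3 - (a + b + c)) / 2 + c)) * h1 -
      2 * sin ((π / 3 - a + c + b) / 2) * cos ((π / 3 - (a + b + c)) / 2 + b) *
        cos ((π / 3 - (a + b + c)) / 2 + c) * h

/-- Metric and trigonometric relations at the point `X` of a Morley configuration. -/
lemma morley_relations {A B C X Y Z D : EuclideanSpace ℝ (Fin 2)}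
    (hY : Y ∈ interior (convexHull ℝ {A, B, C}))
    (hZ : Z ∈ interior (convexHull ℝ {A, B, C}))
    (hD : D ∈ interior (convexHull ℝ {A, B, C}))
    (hDBZ : D ∈ line[ℝ, B, Z]) (hDCY : D ∈ line[ℝ, C, Y])
    (hAngX : ∠ B X C = 2 * π / 3 + ∠ Y A Z)
    (hXbis : ∠ B D X = ∠ X D C)
    (hXin : X ∈ interior (convexHull ℝ {B, D, C})) :
    ∠ Y A Z < π / 3 ∧ 0 < ∠ Z B X ∧ 0 < sin (∠ Z B X) ∧
    dist B X * sin (∠ Z B X) = dist C X * sin (∠ X C Y) ∧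
    sin (∠ B C Y) * (sin (∠ Z B X) *
        cos ((π / 3 - (∠ Y A Z + ∠ Z B X + ∠ X C Y)) / 2 + ∠ Z B X)) =
      sin (∠ C B Z) * (sin (∠ X C Y) *
        cos ((π / 3 - (∠ Y A Z + ∠ Z B X + ∠ X C Y)) / 2 + ∠ X C Y)) := by
  have hXin' : X ∈ interior (convexHull ℝ {D, B, C}) := by rwa [Set.insert_comm]
  have hXin'' : X ∈ interior (convexHull ℝ {D, C, B}) := by rwa [Set.pair_comm]
  have hXin3 : X ∈ interior (convexHull ℝ {B, C, D}) := by rwa [Set.pair_comm]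
  have hB : ∀ Q, ∠ D B Q = ∠ Z B Q := fun Q => angle_eq_of_mem_line Q hZ hD hDBZ
  have hC : ∀ Q, ∠ D C Q = ∠ Y C Q := fun Q => by
    rw [Set.pair_comm] at hY hD
    exact angle_eq_of_mem_line Q hY hD hDCY
  have dDB := triDet_ne_zero_of_mem_interior hXin'
  have dDC := triDet_ne_zero_of_mem_interior hXin''
  have dBC := triDet_ne_zero_of_mem_interior hXin3
  have hb := angle_pos_lt_pi_of_triDet_ne_zero
    (P := B) (Q := D) (R := X) (by rwa [triDet_swap, neg_ne_zero])
  have hxB := angle_pos_lt_pi_of_triDet_ne_zero dBC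
  have hxC := angle_pos_lt_pi_of_triDet_ne_zero
    (P := C) (Q := B) (R := X) (by rwa [triDet_swap, neg_ne_zero])
  obtain ⟨nDB, -, nBX⟩ := ne_of_triDet_ne_zero dDB
  obtain ⟨nDC, -, nCX⟩ := ne_of_triDet_ne_zero dDC
  have addB := angle_add_of_mem_interior hXin'
  have addC := angle_add_of_mem_interior hXin''
  rw [hB, hB] at addB
  rw [hC, hC] at addC
  rw [hB] at hb
  have hsum := angle_add_angle_add_angle_eq_pi C nBX.symm
  have hBC : dist B C ≠ 0 := dist_ne_zero.2 (ne_of_triDet_ne_zero dBC).1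
  have sine : dist B X * sin (∠ C B X) = dist C X * sin (∠ B C X) := by
    have h1 := abs_triDet B C X
    have h2 := abs_triDet C B X
    rw [triDet_swap, abs_neg, dist_comm C B] at h2
    exact mul_left_cancel₀ hBC (by linarith)
  have bisB : dist D X * sin (∠ B D X) = dist B X * sin (∠ Z B X) := by
    have h1 := abs_triDet D B X
    have h2 := abs_triDet B D X
    rw [triDet_swap, abs_neg, dist_comm B D, hB] at h2
    exact mul_left_cancel₀ (dist_ne_zero.2 nDB) (by linarith)
  have bisC : dist D X * sin (∠ X D C) = dist C X * sin (∠ X C Y) := by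
    have h1 := abs_triDet D C X
    have h2 := abs_triDet C D X
    rw [triDet_swap, abs_neg, dist_comm C D, hC, angle_comm Y C X] at h2
    rw [angle_comm X D C]
    exact mul_left_cancel₀ (dist_ne_zero.2 nDC) (by linarith)
  have bis : dist B X * sin (∠ Z B X) = dist C X * sin (∠ X C Y) := by
    rw [← bisB, ← bisC, hXbis]
  have hsum' : ∠ C B X + ∠ B C X = π / 3 - ∠ Y A Z := by
    linarith [angle_comm X C B]
  refine ⟨by linarith, hb.1, hb.2.2, bis, ?_⟩
  have ratio : sin (∠ C B X) * sin (∠ X C Y) = sin (∠ Z B X) * sin (∠ B C X) := by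
    apply mul_left_cancel₀ (mul_ne_zero (dist_ne_zero.2 nBX) (dist_ne_zero.2 nCX))
    linear_combination (dist C X * sin (∠ X C Y)) * sine - (dist C X * sin (∠ B C X)) * bis
  have hθ : sin (∠ C B X + ∠ B C X) ≠ 0 :=
    (sin_pos_of_pos_of_lt_pi (by linarith)
      (by linarith [angle_nonneg Y A Z, pi_pos])).ne'
  have := sin_add_mul_cos_eq hsum' hθ ratio
  rwa [angle_comm B C Y, angle_comm C B Z, addB, addC, angle_comm Y C X, angle_comm X C B,
    angle_comm X B C, add_comm (∠ X C Y) (∠ B C X), add_comm (∠ Z B X) (∠ C B X)]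

/-- Trigonometric form of the ratio of two barycentric coordinates of `X` with respect to `A B C`,
where `s : t` is the ratio `C X : B X`. -/
lemma weights_ratio {A B C X : EuclideanSpace ℝ (Fin 2)} {x y z s t : ℝ}
    (h0 : triDet A B C ≠ 0) (hy : 0 < y) (hz : 0 < z) (hs : x + y + z = 1)
    (hX : X = x • A + y • B + z • C) (hst : dist B X * s = dist C X * t) :
    z * dist A C * sin (∠ A C X) * s = y * dist A B * sin (∠ A B X) * t := by
  have e1 : |triDet B A X| = z * |triDet A B C| := by
    rw [triDet_swap, abs_neg, hX, triDet_combination A B C hs, abs_mul, abs_of_pos hz]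
  have e2 : |triDet C A X| = y * |triDet A B C| := by
    rw [triDet_swap, abs_neg, hX, add_right_comm, triDet_combination A C B (by linarith), abs_mul,
      abs_of_pos hy, triDet_rotate B A C, triDet_swap, abs_neg]
  rw [abs_triDet, dist_comm B A] at e1
  rw [abs_triDet, dist_comm C A] at e2
  have hS := abs_pos.2 h0
  have hBX : dist B X ≠ 0 := by
    intro h
    rw [h, mul_zero, zero_mul] at e1
    exact (mul_pos hz hS).ne e1
  apply mul_left_cancel₀ (mul_ne_zero hBX hS.ne')
  linear_combination (dist A C * sin (∠ A C X) * z * |triDet A B C|) * hst +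
    (t * dist A B * sin (∠ A B X)) * dist B X * e2 - (t * dist A C * sin (∠ A C X)) * dist C X * e1

/-- The converse of Ceva's theorem, in terms of the barycentric coordinates of `X`, `Y`, `Z`. -/
lemma exists_mem_lines_of_weights {A B C X Y Z : EuclideanSpace ℝ (Fin 2)}
    {x₁ x₂ x₃ y₁ y₂ y₃ z₁ z₂ z₃ : ℝ}
    (hx₂ : 0 < x₂) (hx₃ : 0 < x₃) (hy₁ : 0 < y₁) (hy₃ : 0 < y₃) (hz₂ : 0 < z₂)
    (hxs : x₁ + x₂ + x₃ = 1) (hys : y₁ + y₂ + y₃ = 1) (hzs : z₁ + z₂ + z₃ = 1)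
    (hX : X = x₁ • A + x₂ • B + x₃ • C) (hY : Y = y₁ • A + y₂ • B + y₃ • C)
    (hZ : Z = z₁ • A + z₂ • B + z₃ • C) (h : x₃ * y₁ * z₂ = x₂ * y₃ * z₁) :
    ∃ P : EuclideanSpace ℝ (Fin 2),
      P ∈ line[ℝ, A, X] ∧ P ∈ line[ℝ, B, Y] ∧ P ∈ line[ℝ, C, Z] := by
  have hσ : 0 < x₃ * y₁ + x₂ * y₃ + x₃ * y₃ := by positivity
  set σ := x₃ * y₁ + x₂ * y₃ + x₃ * y₃ with hσd
  refine ⟨(x₃ * y₁ / σ) • A + (x₂ * y₃ / σ) • B + (x₃ * y₃ / σ) • C,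
    mem_affineSpan_pair_iff_exists_lineMap_eq.2 ⟨y₃ / σ, ?_⟩,
    mem_affineSpan_pair_iff_exists_lineMap_eq.2 ⟨x₃ / σ, ?_⟩,
    mem_affineSpan_pair_iff_exists_lineMap_eq.2 ⟨x₂ * y₃ / (σ * z₂), ?_⟩⟩
  · obtain rfl : x₁ = 1 - x₂ - x₃ := by linarith
    rw [hX, AffineMap.lineMap_apply_module]
    match_scalars <;> field_simp
    rw [hσd]
    ring
  · obtain rfl : y₂ = 1 - y₁ - y₃ := by linarith
    rw [hY, AffineMap.lineMap_apply_module]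
    match_scalars <;> field_simp
    rw [hσd]
    ring
  · obtain rfl : z₃ = 1 - z₁ - z₂ := by linarith
    rw [hZ, AffineMap.lineMap_apply_module]
    match_scalars <;> field_simp
    · rw [hσd]; linear_combination h
    · linear_combination -h

theorem generalized_morley_perspective
    (A B C X Y Z D E F : EuclideanSpace ℝ (Fin 2))
    (hABC : AffineIndependent ℝ ![A, B, C])
    (hX : X ∈ interior (convexHull ℝ {A, B, C}))
    (hY : Y ∈ interior (convexHull ℝ {A, B, C}))
    (hZ : Z ∈ interior (convexHull ℝ {A, B, C}))
    (hD : D ∈ interior (convexHull ℝ {A, B, C}))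
    (hE : E ∈ interior (convexHull ℝ {A, B, C}))
    (hF : F ∈ interior (convexHull ℝ {A, B, C}))
    (hDBZ : D ∈ line[ℝ, B, Z]) (hDCY : D ∈ line[ℝ, C, Y])
    (hECX : E ∈ line[ℝ, C, X]) (hEAZ : E ∈ line[ℝ, A, Z])
    (hFAY : F ∈ line[ℝ, A, Y]) (hFBX : F ∈ line[ℝ, B, X])
    (hAngX : ∠ B X C = 2 * π / 3 + ∠ Y A Z)
    (hAngY : ∠ C Y A = 2 * π / 3 + ∠ Z B X)
    (hAngZ : ∠ A Z B = 2 * π / 3 + ∠ X C Y)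
    (hXbis : ∠ B D X = ∠ X D C)
    (hXin : X ∈ interior (convexHull ℝ {B, D, C}))
    (hYbis : ∠ C E Y = ∠ Y E A)
    (hYin : Y ∈ interior (convexHull ℝ {C, E, A}))
    (hZbis : ∠ A F Z = ∠ Z F B)
    (hZin : Z ∈ interior (convexHull ℝ {A, F, B}))
    (hAX : A ≠ X) (hBY : B ≠ Y) (hCZ : C ≠ Z) :
    ∃ P : EuclideanSpace ℝ (Fin 2),
      P ∈ line[ℝ, A, X] ∧ P ∈ line[ℝ, B, Y] ∧ P ∈ line[ℝ, C, Z] := by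
  have h₁ : ({B, C, A} : Set (EuclideanSpace ℝ (Fin 2))) = {A, B, C} := by
    rw [Set.pair_comm, Set.insert_comm]
  have h₂ : ({C, A, B} : Set (EuclideanSpace ℝ (Fin 2))) = {A, B, C} := by
    rw [Set.insert_comm, Set.pair_comm]
  obtain ⟨ha, hb₀, hsb, distX, trigX⟩ := morley_relations hY hZ hD hDBZ hDCY hAngX hXbis hXin
  obtain ⟨hb, hc₀, hsc, distY, trigY⟩ := morley_relations (A := B) (B := C) (C := A)
    (h₁ ▸ hZ) (h₁ ▸ hX) (h₁ ▸ hE) hECX hEAZ hAngY hYbis hYin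
  obtain ⟨hc, ha₀, hsa, distZ, trigZ⟩ := morley_relations (A := C) (B := A) (C := B)
    (h₂ ▸ hX) (h₂ ▸ hY) (h₂ ▸ hF) hFAY hFBX hAngZ hZbis hZin
  have h0 := triDet_ne_zero_of_affineIndependent hABC
  obtain ⟨x₁, x₂, x₃, -, hx₂, hx₃, hxs, hXe⟩ := exists_pos_weights hX
  obtain ⟨y₁, y₂, y₃, hy₁, -, hy₃, hys, hYe⟩ := exists_pos_weights hY
  obtain ⟨z₁, z₂, z₃, hz₁, hz₂, -, hzs, hZe⟩ := exists_pos_weights hZ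
  have rX := weights_ratio h0 hx₂ hx₃ hxs hXe distX
  have rY := weights_ratio (A := B) (B := C) (C := A) (x := y₂) (y := y₃) (z := y₁)
    (by rwa [triDet_rotate]) hy₃ hy₁ (by linarith) (by rw [hYe]; abel) distY
  have rZ := weights_ratio (A := C) (B := A) (C := B) (x := z₃) (y := z₁) (z := z₂)
    (by rwa [← triDet_rotate]) hz₁ hz₂ (by linarith) (by rw [hZe]; abel) distZ
  refine exists_mem_lines_of_weights hx₂ hx₃ hy₁ hy₃ hz₂ hxs hys hzs hXe hYe hZe ?_
  have hAB : dist A B ≠ 0 := dist_ne_zero.2 (ne_of_triDet_ne_zero h0).1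
  have hAC : dist A C ≠ 0 := dist_ne_zero.2 (ne_of_triDet_ne_zero h0).2.1
  have hBC : dist B C ≠ 0 := dist_ne_zero.2 (ne_of_triDet_ne_zero h0).2.2
  have hp := (angle_pos_lt_pi_of_triDet_ne_zero
    (triDet_ne_zero_of_mem_interior (A := C) (B := A) (C := B) (h₂ ▸ hX))).2.2
  have hr := (angle_pos_lt_pi_of_triDet_ne_zero (triDet_ne_zero_of_mem_interior hY)).2.2
  have ht := (angle_pos_lt_pi_of_triDet_ne_zero
    (triDet_ne_zero_of_mem_interior (A := B) (B := C) (C := A) (h₁ ▸ hZ))).2.2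
  generalize ∠ Y A Z = a at *
  generalize ∠ Z B X = b at *
  generalize ∠ X C Y = c at *
  rw [show b + c + a = a + b + c by ring] at trigY
  rw [show c + a + b = a + b + c by ring] at trigZ
  have hga : 0 < cos ((π / 3 - (a + b + c)) / 2 + a) :=
    cos_pos_of_mem_Ioo ⟨by linarith, by linarith⟩
  have hgb : 0 < cos ((π / 3 - (a + b + c)) / 2 + b) :=
    cos_pos_of_mem_Ioo ⟨by linarith, by linarith⟩
  have hgc : 0 < cos ((π / 3 - (a + b + c)) / 2 + c) :=
    cos_pos_of_mem_Ioo ⟨by linarith, by linarith⟩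
  generalize cos ((π / 3 - (a + b + c)) / 2 + a) = ga at *
  generalize cos ((π / 3 - (a + b + c)) / 2 + b) = gb at *
  generalize cos ((π / 3 - (a + b + c)) / 2 + c) = gc at *
  rw [dist_comm B A] at rY
  rw [dist_comm C A, dist_comm C B] at rZ
  have trig : sin (∠ A B X) * sin (∠ B C Y) * sin (∠ C A Z) =
      sin (∠ A C X) * sin (∠ B A Y) * sin (∠ C B Z) := by
    apply mul_right_cancel₀ (b := (sin a * ga) * (sin b * gb) * (sin c * gc)) (by positivity)
    linear_combination
      (sin (∠ A B X) * (sin a * ga) * sin (∠ C A Z) * (sin c * gc)) * trigX +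
      (sin (∠ A B X) * (sin a * ga) * sin (∠ C B Z) * (sin c * gc)) * trigY +
      (sin (∠ C B Z) * (sin c * gc) * sin (∠ A C X) * (sin a * ga)) * trigZ
  apply mul_right_cancel₀ (b := dist A B * dist A C * dist B C * (sin a * sin b * sin c) *
    (sin (∠ A C X) * sin (∠ B A Y) * sin (∠ C B Z))) (by positivity)
  linear_combination
    (y₁ * dist A B * sin (∠ B A Y) * sin c) * (z₂ * dist B C * sin (∠ C B Z) * sin a) * rX +
    (x₂ * dist A B * sin (∠ A B X) * sin c) * (z₂ * dist B C * sin (∠ C B Z) * sin a) * rY +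
    (x₂ * dist A B * sin (∠ A B X) * sin c) * (y₃ * dist B C * sin (∠ B C Y) * sin a) * rZ +
    (x₂ * y₃ * z₁ * (dist A B * dist A C * dist B C * (sin a * sin b * sin c))) * trig
end

section
/- (Six equal angles in the converse configuration) Let X, Y, Z be an affinely independent triple of points in the Euclidean plane ℝ² with dist X Y = dist Y Z = dist Z X (an equilateral triangle). Let D, E, F be points with dist D Y = dist D Z, dist E Z = dist E X, dist F X = dist F Y, such that D and X lie strictly on opposite sides of line YZ, E and Y lie strictly on opposite sides of line ZX, and F and Z lie strictly on opposite sides of line XY. Let A be a point lying on both line EZ and line FY with A and X strictly on opposite sides of line YZ; let B be a point lying on both line FX and line DZ with B and Y strictly on opposite sides of line ZX; and let C be a point lying on both line DY and line EX with C and Z strictly on opposite sides of line XY. Let P, Q, R be circumcenters of the triangles AYZ, BZX, CXY respectively, i.e. dist P A = dist P Y = dist P Z, dist Q B = dist Q Z = dist Q X, and dist R C = dist R X = dist R Y. Then the six angles ∠BXR, ∠CXQ, ∠CYP, ∠AYR, ∠AZQ, ∠BZP are all equal. -/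
open EuclideanGeometry Real

section EquilateralFrame

variable {V : Type*} [NormedAddCommGroup V] [InnerProductSpace ℝ V] {u v : V} {L : ℝ}

theorem inner_comb_of_equilateral (hu : inner ℝ u u = L) (hv : inner ℝ v v = L)
    (huv : inner ℝ u v = L / 2) (a b c d : ℝ) :
    inner ℝ (a • u + b • v) (c • u + d • v) =
      L * (a * c + b * d + (a * d + b * c) / 2) := by
  have hvu : inner ℝ v u = L / 2 := by rw [real_inner_comm, huv]
  simp only [inner_add_left, inner_add_right, real_inner_smul_left, real_inner_smul_right,
    hu, hv, huv, hvu]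
  ring

theorem norm_sq_comb_of_equilateral (hu : inner ℝ u u = L) (hv : inner ℝ v v = L)
    (huv : inner ℝ u v = L / 2) (a b : ℝ) :
    ‖a • u + b • v‖ ^ 2 = L * (a ^ 2 + b ^ 2 + a * b) := by
  rw [← real_inner_self_eq_norm_sq, inner_comb_of_equilateral hu hv huv]
  ring

theorem linearIndependent_of_equilateral (hL : 0 < L) (hu : inner ℝ u u = L)
    (hv : inner ℝ v v = L) (huv : inner ℝ u v = L / 2) : LinearIndependent ℝ ![u, v] := by
  rw [LinearIndependent.pair_iff]
  intro a b h
  have h1 := norm_sq_comb_of_equilateral hu hv huv a b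
  rw [h, norm_zero, eq_comm] at h1
  have h2 : a ^ 2 + b ^ 2 + a * b = 0 := by
    have : L * (a ^ 2 + b ^ 2 + a * b) = 0 := by rw [h1]; norm_num
    exact (mul_eq_zero.1 this).resolve_left hL.ne'
  constructor <;> nlinarith [sq_nonneg (a + b), sq_nonneg a, sq_nonneg b]

theorem LinearIndependent.pair_coeff_eq (h : LinearIndependent ℝ ![u, v]) {a b c d : ℝ}
    (he : a • u + b • v = c • u + d • v) : a = c ∧ b = d := by
  rw [LinearIndependent.pair_iff] at h
  have := h (a - c) (b - d) (by
    rw [sub_smul, sub_smul, ← sub_eq_zero.2 he]; abel)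
  exact ⟨sub_eq_zero.1 this.1, sub_eq_zero.1 this.2⟩

theorem LinearIndependent.exists_comb_of_finrank_eq_two (h : LinearIndependent ℝ ![u, v])
    (hV : Module.finrank ℝ V = 2) (w : V) : ∃ a b : ℝ, a • u + b • v = w := by
  have hs := h.span_eq_top_of_card_eq_finrank (by simp [hV])
  have hw : w ∈ Submodule.span ℝ (Set.range ![u, v]) := hs ▸ Submodule.mem_top
  rw [Matrix.range_cons, Matrix.range_cons, Matrix.range_empty, Set.union_empty,
    Set.singleton_union] at hw
  exact Submodule.mem_span_pair.1 hw

theorem exists_sub_eq_of_sOppSide {X Y Z D : V} (h : line[ℝ, Y, Z].SOppSide D X) :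
    ∃ k : ℝ, 1 < k ∧ ∃ t : ℝ, D - X = (k * (1 - t)) • (Y - X) + (k * t) • (Z - X) := by
  obtain ⟨p, hp, hw⟩ := AffineSubspace.wOppSide_iff_exists_wbtw.1 h.wOppSide
  obtain ⟨t, rfl⟩ := mem_affineSpan_pair_iff_exists_lineMap_eq.1 hp
  obtain ⟨s, ⟨hs0, hs1⟩, hs⟩ := hw
  have hs0' : s ≠ 0 := by
    rintro rfl
    apply h.left_notMem
    rw [AffineMap.lineMap_apply_zero] at hs
    rw [hs]; exact hp
  have hs1' : s ≠ 1 := by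
    rintro rfl
    apply h.right_notMem
    rw [AffineMap.lineMap_apply_one] at hs
    rw [hs]; exact hp
  have hpos : 0 < 1 - s := sub_pos.2 (lt_of_le_of_ne hs1 hs1')
  have hspos : 0 < s := lt_of_le_of_ne hs0 (Ne.symm hs0')
  refine ⟨(1 - s)⁻¹, (one_lt_inv₀ hpos).2 (by linarith), t, ?_⟩
  have key : (1 - s) • (D - X) = (1 - t) • (Y - X) + t • (Z - X) := by
    simp only [AffineMap.lineMap_apply_module] at hs
    calc (1 - s) • (D - X) = ((1 - s) • D + s • X) - X := by module
      _ = _ := by rw [hs]; module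
  rw [mul_smul, mul_smul, ← smul_add, ← key, smul_smul, inv_mul_cancel₀ hpos.ne', one_smul]

theorem equilateral_inner {X Y Z : V} (h1 : dist X Y = dist Y Z) (h2 : dist Y Z = dist Z X) :
    inner ℝ (Y - X) (Y - X) = dist X Y ^ 2 ∧ inner ℝ (Z - X) (Z - X) = dist X Y ^ 2 ∧
      inner ℝ (Y - X) (Z - X) = dist X Y ^ 2 / 2 := by
  have hu : ‖Y - X‖ = dist X Y := by rw [dist_comm, dist_eq_norm]
  have hv : ‖Z - X‖ = dist X Y := by rw [h1, h2, dist_eq_norm]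
  have hw : ‖(Y - X) - (Z - X)‖ = dist X Y := by rw [h1, dist_eq_norm, sub_sub_sub_cancel_right]
  refine ⟨by rw [real_inner_self_eq_norm_sq, hu], by rw [real_inner_self_eq_norm_sq, hv], ?_⟩
  have := norm_sub_sq_real (Y - X) (Z - X)
  rw [hu, hv, hw] at this
  linarith

/-- `D` lies on the axis of symmetry through `X` of the triangle `XYZ`, at signed height `d`
beyond the side `YZ`, measured in units of the altitude. -/
theorem exists_eq_of_isosceles {X Y Z D : V} (hne : X ≠ Y) (h1 : dist X Y = dist Y Z)
    (h2 : dist Y Z = dist Z X) (hD : dist D Y = dist D Z)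
    (h : line[ℝ, Y, Z].SOppSide D X) :
    ∃ d : ℝ, 0 < d ∧ D = (-d) • X + ((1 + d) / 2) • Y + ((1 + d) / 2) • Z := by
  obtain ⟨hu, hv, huv⟩ := equilateral_inner h1 h2
  have hL : 0 < dist X Y ^ 2 := pow_pos (dist_pos.2 hne) 2
  obtain ⟨k, hk, t, hDX⟩ := exists_sub_eq_of_sOppSide h
  have hY : D - Y = (k * (1 - t) - 1) • (Y - X) + (k * t) • (Z - X) := by
    rw [← sub_sub_sub_cancel_right D Y X, hDX]; module
  have hZ : D - Z = (k * (1 - t)) • (Y - X) + (k * t - 1) • (Z - X) := by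
    rw [← sub_sub_sub_cancel_right D Z X, hDX]; module
  have he : ‖D - Y‖ ^ 2 = ‖D - Z‖ ^ 2 := by rw [← dist_eq_norm, ← dist_eq_norm, hD]
  rw [hY, hZ, norm_sq_comb_of_equilateral hu hv huv, norm_sq_comb_of_equilateral hu hv huv] at he
  have he' := mul_left_cancel₀ hL.ne' he
  have ht : t = 1 / 2 := by
    have : k * (2 * t - 1) = 0 := by linear_combination he'
    rcases mul_eq_zero.1 this with h | h <;> linarith
  refine ⟨k - 1, by linarith, ?_⟩
  subst ht
  rw [← sub_add_cancel D X, hDX]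
  module

theorem exists_sub_eq_smul_of_mem_line {F X B : V} (h : B ∈ line[ℝ, F, X]) :
    ∃ t : ℝ, B - X = t • (F - X) := by
  obtain ⟨t, rfl⟩ := mem_affineSpan_pair_iff_exists_lineMap_eq.1 h
  exact ⟨1 - t, by rw [AffineMap.lineMap_apply_module]; module⟩

theorem exists_sub_eq_of_lines_meet {X Y Z D E C : V} {d e : ℝ}
    (hli : LinearIndependent ℝ ![Y - X, Z - X]) (he : 0 < e)
    (hD : D = (-d) • X + ((1 + d) / 2) • Y + ((1 + d) / 2) • Z)
    (hE : E = (-e) • Y + ((1 + e) / 2) • Z + ((1 + e) / 2) • X)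
    (hCD : C ∈ line[ℝ, D, Y]) (hCE : C ∈ line[ℝ, E, X]) (hC : line[ℝ, X, Y].SOppSide C Z) :
    ∃ t : ℝ, t < 0 ∧ t * (3 * d * e + d + e - 1) = -(1 + d) ∧
      C - X = (t * (-2 * e)) • (Y - X) + (t * (1 + e)) • (Z - X) := by
  obtain ⟨t, ht⟩ := exists_sub_eq_smul_of_mem_line hCE
  obtain ⟨s, hs⟩ := exists_sub_eq_smul_of_mem_line hCD
  obtain ⟨k, hk, r, hr⟩ := exists_sub_eq_of_sOppSide hC
  have h1 : C - X = (t * (-e)) • (Y - X) + (t * ((1 + e) / 2)) • (Z - X) := by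
    rw [ht, hE]; module
  have h2 : C - X = (1 + s * ((d - 1) / 2)) • (Y - X) + (s * ((1 + d) / 2)) • (Z - X) := by
    rw [← sub_add_sub_cancel C Y X, hs, hD]; module
  have h3 : C - X = (k * r) • (Y - X) + (1 - k) • (Z - X) := by
    rw [← sub_add_sub_cancel C Z X, hr]; module
  obtain ⟨e1, e2⟩ := hli.pair_coeff_eq (h1.symm.trans h2)
  obtain ⟨-, e3⟩ := hli.pair_coeff_eq (h1.symm.trans h3)
  refine ⟨t / 2, ?_, ?_, ?_⟩
  · by_contra! hn
    nlinarith
  · linear_combination -(1 + d) * e1 + (d - 1) * e2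
  · rw [h1]; module

theorem exists_pos_smul_of_circumcenter {X Y Z C R : V} {d e t : ℝ} (hV : Module.finrank ℝ V = 2)
    (hne : X ≠ Y) (h1 : dist X Y = dist Y Z) (h2 : dist Y Z = dist Z X) (hd : 0 < d) (he : 0 < e)
    (ht : t < 0) (hm : t * (3 * d * e + d + e - 1) = -(1 + d))
    (hC : C - X = (t * (-2 * e)) • (Y - X) + (t * (1 + e)) • (Z - X))
    (hR1 : dist R C = dist R X) (hR2 : dist R X = dist R Y) :
    ∃ k : ℝ, 0 < k ∧ R - X = k • ((3 * d * e - 1 + 3 * (d + e)) • (Y - X) +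
      (3 * d * e - 1 - 3 * (d + e)) • (Z - X)) := by
  obtain ⟨hu, hv, huv⟩ := equilateral_inner h1 h2
  have hL : 0 < dist X Y ^ 2 := pow_pos (dist_pos.2 hne) 2
  have hli := linearIndependent_of_equilateral hL hu hv huv
  obtain ⟨a, b, hab⟩ := hli.exists_comb_of_finrank_eq_two hV (R - X)
  have hRY : R - Y = (a - 1) • (Y - X) + b • (Z - X) := by
    rw [← sub_sub_sub_cancel_right R Y X, ← hab]; module
  have hRC : R - C = (a - t * (-2 * e)) • (Y - X) + (b - t * (1 + e)) • (Z - X) := by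
    rw [← sub_sub_sub_cancel_right R C X, ← hab, hC]; module
  have e1 : ‖R - C‖ ^ 2 = ‖R - X‖ ^ 2 := by rw [← dist_eq_norm, ← dist_eq_norm, hR1]
  have e2 : ‖R - X‖ ^ 2 = ‖R - Y‖ ^ 2 := by rw [← dist_eq_norm, ← dist_eq_norm, hR2]
  rw [hRC, ← hab, norm_sq_comb_of_equilateral hu hv huv,
    norm_sq_comb_of_equilateral hu hv huv] at e1
  rw [hRY, ← hab, norm_sq_comb_of_equilateral hu hv huv,
    norm_sq_comb_of_equilateral hu hv huv] at e2
  replace e1 := mul_left_cancel₀ hL.ne' e1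
  replace e2 := mul_left_cancel₀ hL.ne' e2
  have hm0 : 0 < 3 * d * e + d + e - 1 := by
    by_contra! hn
    nlinarith
  set m := 3 * d * e + d + e - 1 with hmdef
  have ha : a = (1 - b) / 2 := by linarith
  subst ha
  have e3 : t * (3 * e ^ 2 + 1) = 3 / 2 * b * (1 + e) + (1 - 3 * e) / 2 := by
    apply mul_left_cancel₀ ht.ne
    linear_combination e1
  have e4 : 3 * m * b = 3 * d * e - 1 - 3 * (d + e) := by
    apply mul_left_cancel₀ (show (1 + e) ≠ 0 by linarith)
    rw [hmdef] at hm ⊢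
    linear_combination (-2) * (3 * d * e + d + e - 1) * e3 + 2 * (3 * e ^ 2 + 1) * hm
  refine ⟨(3 * m)⁻¹, by positivity, ?_⟩
  rw [← hab, smul_add, smul_smul, smul_smul]
  congr 2
  · field_simp
    linear_combination 3 * hmdef - e4
  · field_simp
    linear_combination e4

theorem angle_eq_arccos_of_equilateral (hL : 0 < L) (hu : inner ℝ u u = L)
    (hv : inner ℝ v v = L) (huv : inner ℝ u v = L / 2) (d e f : ℝ) :
    InnerProductGeometry.angle ((-(1 + f)) • u + (2 * f) • v)
      ((3 * d * e - 1 + 3 * (d + e)) • u + (3 * d * e - 1 - 3 * (d + e)) • v) =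
    arccos (3 / 2 * (1 - (d + e + f) - 3 * (d * e + e * f + f * d) + 3 * (d * e * f)) /
      √(3 * ((1 + 3 * d ^ 2) * (1 + 3 * e ^ 2) * (1 + 3 * f ^ 2)))) := by
  have hn : ‖(-(1 + f)) • u + (2 * f) • v‖ *
      ‖(3 * d * e - 1 + 3 * (d + e)) • u + (3 * d * e - 1 - 3 * (d + e)) • v‖ =
      L * √(3 * ((1 + 3 * d ^ 2) * (1 + 3 * e ^ 2) * (1 + 3 * f ^ 2))) := by
    rw [← sq_eq_sq₀ (by positivity) (by positivity), mul_pow, mul_pow, sq_sqrt (by positivity),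
      norm_sq_comb_of_equilateral hu hv huv, norm_sq_comb_of_equilateral hu hv huv]
    ring
  rw [InnerProductGeometry.angle, hn, inner_comb_of_equilateral hu hv huv,
    mul_div_mul_left _ _ hL.ne']
  congr 2
  ring

/-- The expression for the angle is symmetric in the normalized heights `d`, `e`, `f`. -/
theorem angle_circumcenter_eq_arccos {X Y Z D E F B C R : V} {d e f : ℝ}
    (hV : Module.finrank ℝ V = 2) (hne : X ≠ Y) (h1 : dist X Y = dist Y Z)
    (h2 : dist Y Z = dist Z X) (hd : 0 < d) (he : 0 < e) (hf : 0 < f)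
    (hD : D = (-d) • X + ((1 + d) / 2) • Y + ((1 + d) / 2) • Z)
    (hE : E = (-e) • Y + ((1 + e) / 2) • Z + ((1 + e) / 2) • X)
    (hF : F = (-f) • Z + ((1 + f) / 2) • X + ((1 + f) / 2) • Y)
    (hBF : B ∈ line[ℝ, F, X]) (hBD : B ∈ line[ℝ, D, Z]) (hB : line[ℝ, Z, X].SOppSide B Y)
    (hCD : C ∈ line[ℝ, D, Y]) (hCE : C ∈ line[ℝ, E, X]) (hC : line[ℝ, X, Y].SOppSide C Z)
    (hR1 : dist R C = dist R X) (hR2 : dist R X = dist R Y) :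
    ∠ B X R = arccos (3 / 2 * (1 - (d + e + f) - 3 * (d * e + e * f + f * d) + 3 * (d * e * f)) /
      √(3 * ((1 + 3 * d ^ 2) * (1 + 3 * e ^ 2) * (1 + 3 * f ^ 2)))) := by
  obtain ⟨hu, hv, huv⟩ := equilateral_inner h1 h2
  have hL : 0 < dist X Y ^ 2 := pow_pos (dist_pos.2 hne) 2
  have hli := linearIndependent_of_equilateral hL hu hv huv
  have hli' := linearIndependent_of_equilateral hL hv hu (by rw [real_inner_comm, huv])
  obtain ⟨t, ht, hm, hCX⟩ := exists_sub_eq_of_lines_meet hli he hD hE hCD hCE hC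
  obtain ⟨s, hs, -, hBX⟩ := exists_sub_eq_of_lines_meet hli' hf (by rw [hD]; abel)
    (by rw [hF]; abel) hBD hBF (by rwa [Set.pair_comm])
  obtain ⟨k, hk, hRX⟩ := exists_pos_smul_of_circumcenter hV hne h1 h2 hd he ht hm hCX hR1 hR2
  have hBX' : B - X = (-s) • ((-(1 + f)) • (Y - X) + (2 * f) • (Z - X)) := by
    rw [hBX]; module
  rw [EuclideanGeometry.angle, vsub_eq_sub, vsub_eq_sub, hBX', hRX,
    InnerProductGeometry.angle_smul_left_of_pos _ _ (neg_pos.2 hs),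
    InnerProductGeometry.angle_smul_right_of_pos _ _ hk]
  exact angle_eq_arccos_of_equilateral hL hu hv huv d e f

end EquilateralFrame

theorem six_equal_angles
    (X Y Z D E F A B C P Q R : EuclideanSpace ℝ (Fin 2))
    (hXYZ : AffineIndependent ℝ ![X, Y, Z])
    (heq1 : dist X Y = dist Y Z) (heq2 : dist Y Z = dist Z X)
    (hD : dist D Y = dist D Z) (hE : dist E Z = dist E X)
    (hF : dist F X = dist F Y)
    (hDopp : (line[ℝ, Y, Z] : AffineSubspace ℝ (EuclideanSpace ℝ (Fin 2))).SOppSide D X)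
    (hEopp : (line[ℝ, Z, X] : AffineSubspace ℝ (EuclideanSpace ℝ (Fin 2))).SOppSide E Y)
    (hFopp : (line[ℝ, X, Y] : AffineSubspace ℝ (EuclideanSpace ℝ (Fin 2))).SOppSide F Z)
    (hAEZ : A ∈ line[ℝ, E, Z]) (hAFY : A ∈ line[ℝ, F, Y])
    (hAopp : (line[ℝ, Y, Z] : AffineSubspace ℝ (EuclideanSpace ℝ (Fin 2))).SOppSide A X)
    (hBFX : B ∈ line[ℝ, F, X]) (hBDZ : B ∈ line[ℝ, D, Z])
    (hBopp : (line[ℝ, Z, X] : AffineSubspace ℝ (EuclideanSpace ℝ (Fin 2))).SOppSide B Y)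
    (hCDY : C ∈ line[ℝ, D, Y]) (hCEX : C ∈ line[ℝ, E, X])
    (hCopp : (line[ℝ, X, Y] : AffineSubspace ℝ (EuclideanSpace ℝ (Fin 2))).SOppSide C Z)
    (hP1 : dist P A = dist P Y) (hP2 : dist P Y = dist P Z)
    (hQ1 : dist Q B = dist Q Z) (hQ2 : dist Q Z = dist Q X)
    (hR1 : dist R C = dist R X) (hR2 : dist R X = dist R Y) :
    ∠ B X R = ∠ C X Q ∧ ∠ C X Q = ∠ C Y P ∧ ∠ C Y P = ∠ A Y R ∧
    ∠ A Y R = ∠ A Z Q ∧ ∠ A Z Q = ∠ B Z P := by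
  have hV : Module.finrank ℝ (EuclideanSpace ℝ (Fin 2)) = 2 := by simp
  have hXY : X ≠ Y := by simpa using hXYZ.injective.ne (show (0 : Fin 3) ≠ 1 by decide)
  have hYZ : Y ≠ Z := by simpa using hXYZ.injective.ne (show (1 : Fin 3) ≠ 2 by decide)
  have hZX : Z ≠ X := by simpa using hXYZ.injective.ne (show (2 : Fin 3) ≠ 0 by decide)
  have heq3 : dist Z X = dist X Y := (heq1.trans heq2).symm
  have reflect : ∀ {U V W : EuclideanSpace ℝ (Fin 2)}, dist U V = dist V W →
      dist V W = dist W U → dist U W = dist W V ∧ dist W V = dist V U := by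
    intro U V W h1 h2
    rw [dist_comm U W, dist_comm W V, dist_comm V U]
    exact ⟨h2.symm, h1.symm⟩
  obtain ⟨rX1, rX2⟩ := reflect heq1 heq2
  obtain ⟨rY1, rY2⟩ := reflect heq2 heq3
  obtain ⟨rZ1, rZ2⟩ := reflect heq3 heq1
  obtain ⟨d, hd, hDe⟩ := exists_eq_of_isosceles hXY heq1 heq2 hD hDopp
  obtain ⟨e, he, hEe⟩ := exists_eq_of_isosceles hYZ heq2 heq3 hE hEopp
  obtain ⟨f, hf, hFe⟩ := exists_eq_of_isosceles hZX heq3 heq1 hF hFopp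
  have hDe' := hDe.trans (add_right_comm _ _ _)
  have hEe' := hEe.trans (add_right_comm _ _ _)
  have hFe' := hFe.trans (add_right_comm _ _ _)
  have hAopp' := hAopp
  have hBopp' := hBopp
  have hCopp' := hCopp
  rw [Set.pair_comm] at hAopp' hBopp' hCopp'
  rw [angle_circumcenter_eq_arccos hV hXY heq1 heq2 hd he hf hDe hEe hFe hBFX hBDZ hBopp
      hCDY hCEX hCopp hR1 hR2,
    angle_circumcenter_eq_arccos hV hZX.symm rX1 rX2 hd hf he hDe' hFe' hEe' hCEX hCDY hCopp'
      hBDZ hBFX hBopp' (hQ1.trans hQ2) hQ2.symm,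
    angle_circumcenter_eq_arccos hV hYZ heq2 heq3 he hf hd hEe hFe hDe hCDY hCEX hCopp
      hAEZ hAFY hAopp hP1 hP2,
    angle_circumcenter_eq_arccos hV hXY.symm rY1 rY2 he hd hf hEe' hDe' hFe' hAFY hAEZ hAopp'
      hCEX hCDY hCopp' (hR1.trans hR2) hR2.symm,
    angle_circumcenter_eq_arccos hV hZX heq3 heq1 hf hd he hFe hDe hEe hAEZ hAFY hAopp
      hBFX hBDZ hBopp hQ1 hQ2,
    angle_circumcenter_eq_arccos hV hYZ.symm rZ1 rZ2 hf he hd hFe' hEe' hDe' hBDZ hBFX hBopp'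
      hAFY hAEZ hAopp' (hP1.trans hP2) hP2.symm]
  refine ⟨?_, ?_, ?_, ?_, ?_⟩ <;> ring_nf
end

section
/- (Consequence of the extension) Let A, B, C be an affinely independent triple of points in the Euclidean plane ℝ², and let X, Y, Z be points in the interior of the convex hull of {A, B, C} such that each of the triples A,Y,Z; B,Z,X; C,X,Y is affinely independent. Suppose there exist points O_A, O_B, O_C such that: O_A lies on both line BZ and line CY and satisfies dist O_A A = dist O_A Y = dist O_A Z (O_A is the circumcenter of triangle AYZ); O_B lies on both line CX and line AZ and satisfies dist O_B B = dist O_B Z = dist O_B X (O_B is the circumcenter of triangle BZX); and O_C lies on both line AY and line BX and satisfies dist O_C C = dist O_C X = dist O_C Y (O_C is the circumcenter of triangle CXY). Then the triangle XYZ is equilateral, i.e. dist X Y = dist Y Z = dist Z X. -/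
open EuclideanGeometry Real

theorem dist_sq_eq_coord (P Q : EuclideanSpace ℝ (Fin 2)) :
    dist P Q ^ 2 = (P 0 - Q 0) ^ 2 + (P 1 - Q 1) ^ 2 := by
  rw [EuclideanSpace.dist_eq, Real.sq_sqrt (by positivity), Fin.sum_univ_two, Real.dist_eq,
    Real.dist_eq, sq_abs, sq_abs]

theorem sq_add_sq_pos_of_ne {P Q : EuclideanSpace ℝ (Fin 2)} (h : P ≠ Q) :
    0 < (P 0 - Q 0) ^ 2 + (P 1 - Q 1) ^ 2 := by
  rw [← dist_sq_eq_coord]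
  have := dist_pos.2 h
  positivity

/-- A point equidistant from `Y ≠ Z` is the midpoint of `YZ` displaced by a multiple of the
vector `Z - Y` rotated by a right angle. -/
theorem exists_perp_bisector_param {O Y Z : EuclideanSpace ℝ (Fin 2)} (hYZ : Y ≠ Z)
    (h : dist O Y = dist O Z) :
    ∃ a : ℝ, O 0 = (Y 0 + Z 0) / 2 - a / 2 * (Z 1 - Y 1) ∧
      O 1 = (Y 1 + Z 1) / 2 + a / 2 * (Z 0 - Y 0) := by
  have hpos := sq_add_sq_pos_of_ne hYZ
  have h2 : dist O Y ^ 2 = dist O Z ^ 2 := by rw [h]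
  rw [dist_sq_eq_coord, dist_sq_eq_coord] at h2
  set N := (Y 0 - Z 0) ^ 2 + (Y 1 - Z 1) ^ 2 with hN
  refine ⟨((2 * O 1 - Y 1 - Z 1) * (Z 0 - Y 0) - (2 * O 0 - Y 0 - Z 0) * (Z 1 - Y 1)) / N,
    ?_, ?_⟩
  · field_simp
    rw [hN]
    linear_combination (Z 0 - Y 0) * h2
  · field_simp
    rw [hN]
    linear_combination (Z 1 - Y 1) * h2

/-- If `O` lies on line `AY` and `O ≠ Y`, then `A - Y` is a nonzero multiple of `O - Y`. -/
theorem exists_sub_eq_mul_of_mem_line {O A Y : EuclideanSpace ℝ (Fin 2)}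
    (hO : O ∈ line[ℝ, A, Y]) (hOY : O ≠ Y) :
    ∃ s : ℝ, s ≠ 0 ∧ A 0 - Y 0 = s * (O 0 - Y 0) ∧ A 1 - Y 1 = s * (O 1 - Y 1) := by
  obtain ⟨k, rfl⟩ := mem_affineSpan_pair_iff_exists_lineMap_eq.1 hO
  have hk : 1 - k ≠ 0 := by
    intro hk
    apply hOY
    rw [← sub_eq_zero.1 hk, AffineMap.lineMap_apply_one]
  refine ⟨(1 - k)⁻¹, inv_ne_zero hk, ?_, ?_⟩ <;>
  · simp only [AffineMap.lineMap_apply, vsub_eq_sub, vadd_eq_add, PiLp.add_apply,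
      PiLp.smul_apply, PiLp.sub_apply, smul_eq_mul]
    field_simp
    ring

/-- The inscribed angle theorem at `A`, in terms of the parameters of the three circumcenters. -/
theorem inscribed_angle_relation {A X Y Z OA OB OC : EuclideanSpace ℝ (Fin 2)} {a b c : ℝ}
    (hYC : OC ≠ Y) (hZB : OB ≠ Z)
    (hC : OC ∈ line[ℝ, A, Y]) (hB : OB ∈ line[ℝ, A, Z]) (hd : dist OA A = dist OA Y)
    (ha0 : OA 0 = (Y 0 + Z 0) / 2 - a / 2 * (Z 1 - Y 1))
    (ha1 : OA 1 = (Y 1 + Z 1) / 2 + a / 2 * (Z 0 - Y 0))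
    (hb0 : OB 0 = (Z 0 + X 0) / 2 - b / 2 * (X 1 - Z 1))
    (hb1 : OB 1 = (Z 1 + X 1) / 2 + b / 2 * (X 0 - Z 0))
    (hc0 : OC 0 = (X 0 + Y 0) / 2 - c / 2 * (Y 1 - X 1))
    (hc1 : OC 1 = (X 1 + Y 1) / 2 + c / 2 * (Y 0 - X 0)) :
    (1 - (a * b + b * c + c * a)) * ((Y 0 - X 0) * (Z 0 - X 0) + (Y 1 - X 1) * (Z 1 - X 1))
      = (a + b + c - a * b * c) *
        ((Y 0 - X 0) * (Z 1 - X 1) - (Y 1 - X 1) * (Z 0 - X 0)) := by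
  obtain ⟨s, hs, hs0, hs1⟩ := exists_sub_eq_mul_of_mem_line hC hYC
  obtain ⟨t, ht, ht0, ht1⟩ := exists_sub_eq_mul_of_mem_line hB hZB
  have h2 : dist OA A ^ 2 = dist OA Y ^ 2 := by rw [hd]
  rw [dist_sq_eq_coord, dist_sq_eq_coord, ha0, ha1] at h2
  have h3 : (A 0 - Y 0) * (A 0 - Z 0) + (A 1 - Y 1) * (A 1 - Z 1)
      = a * ((A 0 - Y 0) * (A 1 - Z 1) - (A 1 - Y 1) * (A 0 - Z 0)) := by
    linear_combination h2
  rw [hs0, hs1, ht0, ht1, hb0, hb1, hc0, hc1] at h3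
  apply mul_left_cancel₀ (mul_ne_zero hs ht)
  linear_combination 4 * h3

/-- Every point has barycentric coordinates with respect to a triangle, and these are positive if
the point is in the interior of the triangle. -/
theorem exists_barycentric {A B C : EuclideanSpace ℝ (Fin 2)}
    (h : AffineIndependent ℝ ![A, B, C]) (P : EuclideanSpace ℝ (Fin 2)) :
    ∃ u v w : ℝ, u + v + w = 1 ∧ (∀ i, P i = u * A i + v * B i + w * C i) ∧
      (P ∈ interior (convexHull ℝ {A, B, C}) → 0 < u ∧ 0 < v ∧ 0 < w) := by
  have htop : affineSpan ℝ (Set.range ![A, B, C]) = ⊤ := by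
    rw [h.affineSpan_eq_top_iff_card_eq_finrank_add_one]
    simp
  let b : AffineBasis (Fin 3) ℝ (EuclideanSpace ℝ (Fin 2)) := ⟨![A, B, C], h, htop⟩
  have hr : Set.range b = {A, B, C} := by
    change Set.range ![A, B, C] = _
    rw [Matrix.range_cons, Matrix.range_cons, Matrix.range_cons, Matrix.range_empty,
      Set.union_empty]
    rfl
  have hs := b.sum_coord_apply_eq_one P
  rw [Fin.sum_univ_three] at hs
  refine ⟨b.coord 0 P, b.coord 1 P, b.coord 2 P, hs, fun i => ?_, fun hP => ?_⟩
  · have := congrArg (fun Q : EuclideanSpace ℝ (Fin 2) => Q i)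
      (b.linear_combination_coord_eq_self P)
    rw [Fin.sum_univ_three] at this
    exact this.symm
  · rw [← hr, b.interior_convexHull] at hP
    exact ⟨hP 0, hP 1, hP 2⟩

/-- A triangle has nonzero signed area. -/
theorem signed_area_ne_zero {A B C : EuclideanSpace ℝ (Fin 2)}
    (h : AffineIndependent ℝ ![A, B, C]) :
    (B 0 - A 0) * (C 1 - A 1) - (B 1 - A 1) * (C 0 - A 0) ≠ 0 := by
  intro h0
  have hBA : B ≠ A := fun e => by simpa using h.injective.ne (show (1 : Fin 3) ≠ 0 by decide) e
  obtain ⟨u, v, w, hs, hP, -⟩ :=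
    exists_barycentric h !₂[A 0 - (B 1 - A 1), A 1 + (B 0 - A 0)]
  have p0 : A 0 - (B 1 - A 1) = u * A 0 + v * B 0 + w * C 0 := hP 0
  have p1 : A 1 + (B 0 - A 0) = u * A 1 + v * B 1 + w * C 1 := hP 1
  have hpos := sq_add_sq_pos_of_ne hBA
  have : (B 0 - A 0) ^ 2 + (B 1 - A 1) ^ 2 = 0 := by
    obtain rfl : u = 1 - v - w := by linarith
    linear_combination (B 0 - A 0) * p1 - (B 1 - A 1) * p0 + w * h0
  exact hpos.ne' this

/-- In the frame given by a nonzero vector and its rotation by a right angle, only the zero vector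
has zero coordinates. -/
theorem rotation_frame_coord_eq_zero {e f x y : ℝ} (h : 0 < e ^ 2 + f ^ 2)
    (h0 : x * e - y * f = 0) (h1 : x * f + y * e = 0) : x = 0 ∧ y = 0 := by
  constructor
  · apply mul_right_cancel₀ h.ne'
    linear_combination e * h0 + f * h1
  · apply mul_right_cancel₀ h.ne'
    linear_combination e * h1 - f * h0

/-- The three oriented areas `XBC`, `YCA`, `ZAB` of a collinear configuration cannot all have the
same sign. -/
theorem not_same_sign_of_collinear {a b c s s' t t' w w' y D : ℝ}
    (h1 : s - s' = 1) (h2 : c * s + a * s' = 0) (h3 : t - t' = y) (h4 : b * t + a * t' = 0)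
    (h5 : w - w' = 1 - y) (h6 : c * w + b * w' = 0)
    (hX : 0 < -(s * t * (b + c)) * D) (hY : 0 < -(t' * w * (c + a)) * D)
    (hZ : 0 < -(w' * s' * (a + b)) * D) : False := by
  have e1 : (a + c) * s = a := by linear_combination h2 + a * h1
  have e2 : (a + c) * s' = -c := by linear_combination h2 - c * h1
  have e3 : (a + b) * t = a * y := by linear_combination h4 + a * h3
  have e4 : (a + b) * t' = -(b * y) := by linear_combination h4 - b * h3
  have e5 : (b + c) * w = b * (1 - y) := by linear_combination h6 + b * h5
  have e6 : (b + c) * w' = -(c * (1 - y)) := by linear_combination h6 - c * h5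
  have hD : D ≠ 0 := by rintro rfl; simp at hX
  have hab : a + b ≠ 0 := by intro h; simp [h] at hZ
  have hbc : b + c ≠ 0 := by intro h; simp [h] at hX
  have p1 : 0 < (a + b) ^ 2 * D ^ 2 * (s * t * (b + c) * (t' * w * (c + a))) := by
    have h : 0 < (a + b) ^ 2 := by positivity
    have := mul_pos h (mul_pos hX hY)
    linarith
  have p2 : 0 < (b + c) ^ 2 * D ^ 2 * (t' * w * (c + a) * (w' * s' * (a + b))) := by
    have h : 0 < (b + c) ^ 2 := by positivity
    have := mul_pos h (mul_pos hY hZ)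
    linarith
  have q1 : (a + b) ^ 2 * D ^ 2 * (s * t * (b + c) * (t' * w * (c + a)))
      = (D * a * b * y) ^ 2 * (y - 1) := by
    calc _ = D ^ 2 * ((a + c) * s) * ((a + b) * t) * ((a + b) * t') * ((b + c) * w) := by ring
      _ = _ := by rw [e1, e3, e4, e5]; ring
  have q2 : (b + c) ^ 2 * D ^ 2 * (t' * w * (c + a) * (w' * s' * (a + b)))
      = (D * b * c * (1 - y)) ^ 2 * (-y) := by
    calc _ = D ^ 2 * ((a + c) * s') * ((a + b) * t') * ((b + c) * w) * ((b + c) * w') := by ring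
      _ = _ := by rw [e2, e4, e5, e6]; ring
  rw [q1] at p1
  rw [q2] at p2
  have := pos_of_mul_pos_right p1 (sq_nonneg _)
  have := pos_of_mul_pos_right p2 (sq_nonneg _)
  linarith

theorem morley_extension_consequence
    (A B C X Y Z : EuclideanSpace ℝ (Fin 2))
    (hABC : AffineIndependent ℝ ![A, B, C])
    (hX : X ∈ interior (convexHull ℝ {A, B, C}))
    (hY : Y ∈ interior (convexHull ℝ {A, B, C}))
    (hZ : Z ∈ interior (convexHull ℝ {A, B, C}))
    (hAYZ : AffineIndependent ℝ ![A, Y, Z])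
    (hBZX : AffineIndependent ℝ ![B, Z, X])
    (hCXY : AffineIndependent ℝ ![C, X, Y])
    (OA OB OC : EuclideanSpace ℝ (Fin 2))
    (hOA1 : OA ∈ line[ℝ, B, Z]) (hOA2 : OA ∈ line[ℝ, C, Y])
    (hOA3 : dist OA A = dist OA Y) (hOA4 : dist OA Y = dist OA Z)
    (hOB1 : OB ∈ line[ℝ, C, X]) (hOB2 : OB ∈ line[ℝ, A, Z])
    (hOB3 : dist OB B = dist OB Z) (hOB4 : dist OB Z = dist OB X)
    (hOC1 : OC ∈ line[ℝ, A, Y]) (hOC2 : OC ∈ line[ℝ, B, X])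
    (hOC3 : dist OC C = dist OC X) (hOC4 : dist OC X = dist OC Y) :
    dist X Y = dist Y Z ∧ dist Y Z = dist Z X := by
  have hYZ : Y ≠ Z := fun h => by simpa using hAYZ.injective.ne (show (1 : Fin 3) ≠ 2 by decide) h
  have hZX : Z ≠ X := fun h => by simpa using hBZX.injective.ne (show (1 : Fin 3) ≠ 2 by decide) h
  have hXY : X ≠ Y := fun h => by simpa using hCXY.injective.ne (show (1 : Fin 3) ≠ 2 by decide) h
  have hne : ∀ {O P Q : EuclideanSpace ℝ (Fin 2)}, P ≠ Q → dist O P = dist O Q →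
      O ≠ P ∧ O ≠ Q := by
    intro O P Q hPQ h
    constructor
    · rintro rfl
      rw [dist_self] at h
      exact hPQ (dist_eq_zero.1 h.symm)
    · rintro rfl
      rw [dist_self] at h
      exact hPQ (dist_eq_zero.1 h).symm
  obtain ⟨hAY', hAZ'⟩ := hne hYZ hOA4
  obtain ⟨hBZ', hBX'⟩ := hne hZX hOB4
  obtain ⟨hCX', hCY'⟩ := hne hXY hOC4
  obtain ⟨a, ha0, ha1⟩ := exists_perp_bisector_param hYZ hOA4
  obtain ⟨b, hb0, hb1⟩ := exists_perp_bisector_param hZX hOB4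
  obtain ⟨c, hc0, hc1⟩ := exists_perp_bisector_param hXY hOC4
  have rA := inscribed_angle_relation hCY' hBZ' hOC1 hOB2 hOA3 ha0 ha1 hb0 hb1 hc0 hc1
  have rB := inscribed_angle_relation hAZ' hCX' hOA1 hOC2 hOB3 hb0 hb1 hc0 hc1 ha0 ha1
  have rC := inscribed_angle_relation hBX' hAY' hOB1 hOA2 hOC3 hc0 hc1 ha0 ha1 hb0 hb1
  by_cases hD : (Y 0 - X 0) * (Z 1 - X 1) - (Y 1 - X 1) * (Z 0 - X 0) = 0
  · exfalso
    obtain ⟨s, -, hs0, hs1⟩ := exists_sub_eq_mul_of_mem_line hOC2 hCX'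
    obtain ⟨s', -, hs'0, hs'1⟩ := exists_sub_eq_mul_of_mem_line hOA1 hAZ'
    obtain ⟨t, -, ht0, ht1⟩ := exists_sub_eq_mul_of_mem_line hOB1 hBX'
    obtain ⟨t', -, ht'0, ht'1⟩ := exists_sub_eq_mul_of_mem_line hOA2 hAY'
    obtain ⟨w, -, hw0, hw1⟩ := exists_sub_eq_mul_of_mem_line hOC1 hCY'
    obtain ⟨w', -, hw'0, hw'1⟩ := exists_sub_eq_mul_of_mem_line hOB2 hBZ'
    have hN := sq_add_sq_pos_of_ne hZX
    obtain ⟨y, hy0, hy1⟩ : ∃ y : ℝ, Y 0 - X 0 = y * (Z 0 - X 0) ∧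
        Y 1 - X 1 = y * (Z 1 - X 1) := by
      refine ⟨((Y 0 - X 0) * (Z 0 - X 0) + (Y 1 - X 1) * (Z 1 - X 1)) /
        ((Z 0 - X 0) ^ 2 + (Z 1 - X 1) ^ 2), ?_, ?_⟩
      · rw [div_mul_eq_mul_div, eq_div_iff hN.ne']
        linear_combination (Z 1 - X 1) * hD
      · rw [div_mul_eq_mul_div, eq_div_iff hN.ne']
        linear_combination (-(Z 0 - X 0)) * hD
    have hΔ := signed_area_ne_zero hABC
    obtain ⟨u, v, w₀, hs, hP, hpos⟩ := exists_barycentric hABC X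
    obtain ⟨u', v', w₀', hs', hP', hpos'⟩ := exists_barycentric hABC Y
    obtain ⟨u'', v'', w₀'', hs'', hP'', hpos''⟩ := exists_barycentric hABC Z
    have hu := (hpos hX).1
    have hv := (hpos' hY).2.1
    have hw := (hpos'' hZ).2.2
    set Δ := (B 0 - A 0) * (C 1 - A 1) - (B 1 - A 1) * (C 0 - A 0) with hΔdef
    have aX : (B 0 - X 0) * (C 1 - X 1) - (B 1 - X 1) * (C 0 - X 0) = u * Δ := by
      obtain rfl : u = 1 - v - w₀ := by linarith
      rw [hP 0, hP 1]; ring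
    have aY : (C 0 - Y 0) * (A 1 - Y 1) - (C 1 - Y 1) * (A 0 - Y 0) = v' * Δ := by
      obtain rfl : u' = 1 - v' - w₀' := by linarith
      rw [hP' 0, hP' 1]; ring
    have aZ : (A 0 - Z 0) * (B 1 - Z 1) - (A 1 - Z 1) * (B 0 - Z 0) = w₀'' * Δ := by
      obtain rfl : u'' = 1 - v'' - w₀'' := by linarith
      rw [hP'' 0, hP'' 1]; ring
    clear hP hP' hP''
    clear_value Δ
    set e := Z 0 - X 0 with he
    set f := Z 1 - X 1 with hf
    obtain ⟨S, hS⟩ : ∃ S, S = s * y / 2 := ⟨_, rfl⟩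
    obtain ⟨S', hS'⟩ : ∃ S', S' = -(s' * (1 - y) / 2) := ⟨_, rfl⟩
    obtain ⟨T, hT⟩ : ∃ T, T = t / 2 := ⟨_, rfl⟩
    obtain ⟨T', hT'⟩ : ∃ T', T' = t' * (1 - y) / 2 := ⟨_, rfl⟩
    obtain ⟨W, hW⟩ : ∃ W, W = -(w * y / 2) := ⟨_, rfl⟩
    obtain ⟨W', hW'⟩ : ∃ W', W' = -(w' / 2) := ⟨_, rfl⟩
    have z0 : Z 0 = X 0 + e := by rw [he]; ring
    have z1 : Z 1 = X 1 + f := by rw [hf]; ring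
    have y0 : Y 0 = X 0 + y * e := by linear_combination hy0
    have y1 : Y 1 = X 1 + y * f := by linear_combination hy1
    have bx0 : B 0 - X 0 = S * (e - c * f) := by rw [hs0, hc0, y0, y1, hS]; ring
    have bx1 : B 1 - X 1 = S * (f + c * e) := by rw [hs1, hc1, y0, y1, hS]; ring
    have bz0 : B 0 - Z 0 = S' * (e + a * f) := by rw [hs'0, ha0, y0, y1, z0, z1, hS']; ring
    have bz1 : B 1 - Z 1 = S' * (f - a * e) := by rw [hs'1, ha1, y0, y1, z0, z1, hS']; ring
    have cx0 : C 0 - X 0 = T * (e + b * f) := by rw [ht0, hb0, z0, z1, hT]; ring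
    have cx1 : C 1 - X 1 = T * (f - b * e) := by rw [ht1, hb1, z0, z1, hT]; ring
    have cy0 : C 0 - Y 0 = T' * (e - a * f) := by rw [ht'0, ha0, y0, y1, z0, z1, hT']; ring
    have cy1 : C 1 - Y 1 = T' * (f + a * e) := by rw [ht'1, ha1, y0, y1, z0, z1, hT']; ring
    have ay0 : A 0 - Y 0 = W * (e + c * f) := by rw [hw0, hc0, y0, y1, hW]; ring
    have ay1 : A 1 - Y 1 = W * (f - c * e) := by rw [hw1, hc1, y0, y1, hW]; ring
    have az0 : A 0 - Z 0 = W' * (e - b * f) := by rw [hw'0, hb0, z0, z1, hW']; ring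
    have az1 : A 1 - Z 1 = W' * (f + b * e) := by rw [hw'1, hb1, z0, z1, hW']; ring
    obtain ⟨k1, k2⟩ := rotation_frame_coord_eq_zero (x := S - S' - 1) (y := c * S + a * S') hN
      (by linear_combination bz0 - bx0 + z0) (by linear_combination bz1 - bx1 + z1)
    obtain ⟨k3, k4⟩ := rotation_frame_coord_eq_zero (x := T - T' - y) (y := -(b * T + a * T')) hN
      (by linear_combination cy0 - cx0 + y0) (by linear_combination cy1 - cx1 + y1)
    obtain ⟨k5, k6⟩ := rotation_frame_coord_eq_zero (x := W - W' - (1 - y))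
      (y := -(c * W + b * W')) hN
      (by linear_combination az0 - ay0 + z0 - y0) (by linear_combination az1 - ay1 + z1 - y1)
    rw [bx0, bx1, cx0, cx1] at aX
    rw [cy0, cy1, ay0, ay1] at aY
    rw [az0, az1, bz0, bz1] at aZ
    have hΔ2 : 0 < Δ ^ 2 := by positivity
    refine not_same_sign_of_collinear (D := (e ^ 2 + f ^ 2) * Δ) (sub_eq_zero.1 k1) k2
      (sub_eq_zero.1 k3) (neg_eq_zero.1 k4) (sub_eq_zero.1 k5) (neg_eq_zero.1 k6) ?_ ?_ ?_
    · have := mul_pos hu hΔ2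
      linear_combination this - Δ * aX
    · have := mul_pos hv hΔ2
      linear_combination this - Δ * aY
    · have := mul_pos hw hΔ2
      linear_combination this - Δ * aZ
  · have hRe : 1 - (a * b + b * c + c * a) ≠ 0 := by
      intro h
      have hI : a + b + c - a * b * c = 0 := by
        rw [h, zero_mul] at rA
        exact (mul_eq_zero.1 rA.symm).resolve_right hD
      have : (1 + a ^ 2) * (1 + b ^ 2) * (1 + c ^ 2) = 0 := by
        linear_combination (1 - (a * b + b * c + c * a)) * h + (a + b + c - a * b * c) * hI
      have : 0 < (1 + a ^ 2) * (1 + b ^ 2) * (1 + c ^ 2) := by positivity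
      linarith
    have d1 := mul_left_cancel₀ hRe (show (1 - (a * b + b * c + c * a)) *
        ((Y 0 - X 0) * (Z 0 - X 0) + (Y 1 - X 1) * (Z 1 - X 1)) =
        (1 - (a * b + b * c + c * a)) *
        ((Z 0 - Y 0) * (X 0 - Y 0) + (Z 1 - Y 1) * (X 1 - Y 1)) by
      linear_combination rA - rB)
    have d2 := mul_left_cancel₀ hRe (show (1 - (a * b + b * c + c * a)) *
        ((Z 0 - Y 0) * (X 0 - Y 0) + (Z 1 - Y 1) * (X 1 - Y 1)) =
        (1 - (a * b + b * c + c * a)) *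
        ((X 0 - Z 0) * (Y 0 - Z 0) + (X 1 - Z 1) * (Y 1 - Z 1)) by
      linear_combination rB - rC)
    constructor <;> rw [← sq_eq_sq₀ dist_nonneg dist_nonneg, dist_sq_eq_coord, dist_sq_eq_coord]
    · linear_combination d1 + d2
    · linear_combination -d1
end
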